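/- arXiv:1712.06210 — 10 statements merged into one kernel-verified Lean document; each statement's English description precedes it below -/
import Mathlib

section
/- There is an absolute constant C > 0 with the following property. Let L > 0, let N* be a positive integer, set h = L/N*, and let x_i = i·h. For every L-periodic function f : ℝ → ℝ of class C⁶, the truncation error τ_i = (−f(x_{i−2}) + 16 f(x_{i−1}) − 30 f(x_i) + 16 f(x_{i+1}) − f(x_{i+2}))/(12 h²) − f''(x_i) satisfies the discrete ℓ² bound ( h · ∑_{i=0}^{N*−1} τ_i² )^{1/2} ≤ C · h⁴ · ‖f⁽⁶⁾‖_{L²(0,L)}, where f⁽⁶⁾ denotes the sixth derivative of f. -/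
open Real MeasureTheory Finset

/-- The Cauchy–Schwarz inequality against the constant function `1` on an interval. -/
lemma sq_intervalIntegral_le_mul_integral_sq {g : ℝ → ℝ} (hg : Continuous g) {a b : ℝ}
    (hab : a < b) : (∫ t in a..b, g t) ^ 2 ≤ (b - a) * ∫ t in a..b, g t ^ 2 := by
  set J := ∫ t in a..b, g t with hJ
  have hba : 0 < b - a := sub_pos.2 hab
  have hnonneg : 0 ≤ ∫ t in a..b, (g t - J / (b - a)) ^ 2 :=
    intervalIntegral.integral_nonneg hab.le fun _ _ => sq_nonneg _
  have hexpand : ∫ t in a..b, (g t - J / (b - a)) ^ 2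
      = (∫ t in a..b, g t ^ 2) - 2 * (J / (b - a)) * J + (b - a) * (J / (b - a)) ^ 2 := by
    have hpt : ∀ t, (g t - J / (b - a)) ^ 2
        = g t ^ 2 - 2 * (J / (b - a)) * g t + (J / (b - a)) ^ 2 := fun t => by ring
    simp_rw [hpt]
    rw [intervalIntegral.integral_add, intervalIntegral.integral_sub,
      intervalIntegral.integral_const_mul, intervalIntegral.integral_const, smul_eq_mul]
    all_goals exact Continuous.intervalIntegrable (by fun_prop) _ _
  rw [hexpand] at hnonneg
  have hmul := mul_nonneg hba.le hnonneg
  have hsimp : (b - a) * ((∫ t in a..b, g t ^ 2) - 2 * (J / (b - a)) * J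
      + (b - a) * (J / (b - a)) ^ 2) = (b - a) * (∫ t in a..b, g t ^ 2) - J ^ 2 := by
    field_simp
    ring
  linarith

/-- Taylor's theorem with an `L¹` bound on the remainder. -/
lemma abs_sub_taylor_le_integral_abs {f : ℝ → ℝ} {n : ℕ} (hf : ContDiff ℝ (n + 1 : ℕ) f)
    {c r y : ℝ} (hy : |y - c| ≤ r) :
    |f y - ∑ k ∈ Finset.range (n + 1), (y - c) ^ k / (k.factorial : ℝ) * iteratedDeriv k f c|
      ≤ |y - c| ^ n / (n.factorial : ℝ) * ∫ t in (c - r)..(c + r), |iteratedDeriv (n + 1) f t| := by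
  rcases eq_or_ne c y with rfl | hne
  · have hr : 0 ≤ r := (abs_nonneg _).trans hy
    have hint : 0 ≤ ∫ t in (c - r)..(c + r), |iteratedDeriv (n + 1) f t| :=
      intervalIntegral.integral_nonneg (by linarith) fun _ _ => abs_nonneg _
    rw [Finset.sum_range_succ']
    simpa using mul_nonneg (by positivity) hint
  have huniq : UniqueDiffOn ℝ (Set.uIcc c y) := uniqueDiffOn_uIcc hne
  have hderiv : ∀ k ≤ n + 1, ∀ t ∈ Set.uIcc c y,
      iteratedDerivWithin k f (Set.uIcc c y) t = iteratedDeriv k f t := fun k hk t ht =>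
    iteratedDerivWithin_eq_iteratedDeriv huniq
      ((hf.of_le (by exact_mod_cast hk)).contDiffAt) ht
  have hcont : Continuous (iteratedDeriv (n + 1) f) := hf.continuous_iteratedDeriv' (n + 1)
  have htaylor := taylor_integral_remainder (x₀ := c) (x := y) hf.contDiffOn
  have hpoly : taylorWithinEval f n (Set.uIcc c y) c y
      = ∑ k ∈ Finset.range (n + 1), (y - c) ^ k / (k.factorial : ℝ) * iteratedDeriv k f c := by
    rw [taylor_within_apply]
    refine Finset.sum_congr rfl fun k hk => ?_
    rw [hderiv k (Finset.mem_range.1 hk).le c Set.left_mem_uIcc, smul_eq_mul]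
    ring
  rw [← hpoly, htaylor]
  calc |∫ t in c..y, ((y - t) ^ n / (n.factorial : ℝ)) •
          iteratedDerivWithin (n + 1) f (Set.uIcc c y) t|
      ≤ |(∫ t in c..y, |y - c| ^ n / (n.factorial : ℝ) * |iteratedDeriv (n + 1) f t|)| := by
        rw [← Real.norm_eq_abs]
        refine intervalIntegral.norm_integral_le_abs_of_norm_le ?_
          ((hcont.abs.const_mul _).intervalIntegrable _ _)
        refine (ae_restrict_iff' measurableSet_uIoc).2 (Filter.Eventually.of_forall fun t ht => ?_)
        have htc := Set.uIoc_subset_uIcc ht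
        rw [hderiv (n + 1) le_rfl t htc, norm_smul, Real.norm_eq_abs, Real.norm_eq_abs, abs_div,
          abs_pow, Nat.abs_cast]
        gcongr ?_ ^ n / _ * _
        exact Set.abs_sub_right_of_mem_uIcc htc
    _ = |y - c| ^ n / (n.factorial : ℝ) * |(∫ t in c..y, |iteratedDeriv (n + 1) f t|)| := by
        rw [intervalIntegral.integral_const_mul, abs_mul, abs_of_nonneg (by positivity)]
    _ ≤ _ := by
        gcongr
        have hr : 0 ≤ r := (abs_nonneg _).trans hy
        have habs := abs_le.1 hy
        rw [← abs_of_nonneg (a := ∫ t in (c - r)..(c + r), |iteratedDeriv (n + 1) f t|)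
          (intervalIntegral.integral_nonneg (by linarith) fun _ _ => abs_nonneg _)]
        refine intervalIntegral.abs_integral_mono_interval ?_
          (Filter.Eventually.of_forall fun _ => abs_nonneg _)
          (Continuous.intervalIntegrable (by fun_prop) _ _)
        refine Set.Ioc_subset_Ioc ?_ ?_
        · rw [min_eq_left (by linarith)]
          exact le_min (by linarith) (by linarith)
        · rw [max_eq_right (a := c - r) (by linarith)]
          exact max_le (by linarith) (by linarith)

/-- Pointwise truncation error bound for the long stencil second difference. -/
lemma abs_long_stencil_sub_deriv_deriv_le {f : ℝ → ℝ} (hf : ContDiff ℝ 6 f) (c : ℝ) {h : ℝ}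
    (hh : 0 < h) :
    |(-f (c - 2 * h) + 16 * f (c - h) - 30 * f c + 16 * f (c + h) - f (c + 2 * h)) / (12 * h ^ 2)
        - deriv (deriv f) c|
      ≤ h ^ 3 / 15 * ∫ t in (c - 2 * h)..(c + 2 * h), |iteratedDeriv 6 f t| := by
  have hf' : ContDiff ℝ ((5 + 1 : ℕ) : WithTop ℕ∞) f := by exact_mod_cast hf
  have hd : deriv (deriv f) c = iteratedDeriv 2 f c := by
    simp [iteratedDeriv_succ, iteratedDeriv_zero]
  have habs1 : |h| = h := abs_of_pos hh
  have habs2 : |2 * h| = 2 * h := abs_of_pos (by positivity)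
  have e1 := abs_sub_taylor_le_integral_abs hf' (c := c) (r := 2 * h) (y := c - 2 * h)
    (by rw [sub_sub_cancel_left, abs_neg, habs2])
  have e2 := abs_sub_taylor_le_integral_abs hf' (c := c) (r := 2 * h) (y := c - h)
    (by rw [sub_sub_cancel_left, abs_neg, habs1]; linarith)
  have e3 := abs_sub_taylor_le_integral_abs hf' (c := c) (r := 2 * h) (y := c + h)
    (by rw [add_sub_cancel_left, habs1]; linarith)
  have e4 := abs_sub_taylor_le_integral_abs hf' (c := c) (r := 2 * h) (y := c + 2 * h)
    (by rw [add_sub_cancel_left, habs2])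
  simp only [sub_sub_cancel_left, add_sub_cancel_left, abs_neg, habs1, habs2,
    Finset.sum_range_succ, Finset.sum_range_zero, Nat.factorial, iteratedDeriv_zero] at e1 e2 e3 e4
  norm_num at e1 e2 e3 e4
  rw [hd]
  set J := ∫ t in (c - 2 * h)..(c + 2 * h), |iteratedDeriv 6 f t|
  have hden : (0 : ℝ) < 12 * h ^ 2 := by positivity
  have hkey : |-f (c - 2 * h) + 16 * f (c - h) - 30 * f c + 16 * f (c + h) - f (c + 2 * h)
      - 12 * h ^ 2 * iteratedDeriv 2 f c| ≤ h ^ 3 / 15 * J * (12 * h ^ 2) := by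
    rw [abs_le] at e1 e2 e3 e4 ⊢
    constructor <;> linarith [e1.1, e1.2, e2.1, e2.2, e3.1, e3.2, e4.1, e4.2]
  rwa [div_sub' hden.ne', abs_div, abs_of_pos hden, div_le_iff₀ hden]

/-- The derivatives of a periodic function are periodic. -/
lemma Function.Periodic.iteratedDeriv {f : ℝ → ℝ} {L : ℝ} (hf : Function.Periodic f L) (n : ℕ) :
    Function.Periodic (iteratedDeriv n f) L := fun x => by
  have hshift := congrFun (iteratedDeriv_comp_add_const n f L) x
  rw [show (fun z => f (z + L)) = f from funext hf] at hshift
  exact hshift.symm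

/-- Over the nodes of one period, each grid cell is covered four times by the windows
`[x i - 2 * h, x i + 2 * h]`. -/
lemma sum_integral_window_eq_four_mul {g : ℝ → ℝ} (hg : Continuous g) {L h : ℝ} {N : ℕ}
    (hper : Function.Periodic g L) (hN : (N : ℝ) * h = L) :
    ∑ i ∈ Finset.range N, ∫ t in ((i : ℝ) * h - 2 * h)..((i : ℝ) * h + 2 * h), g t
      = 4 * ∫ t in (0 : ℝ)..L, g t := by
  have hint : ∀ a b : ℝ, IntervalIntegrable g volume a b := fun a b => hg.intervalIntegrable a b
  have hcell : ∀ s : ℝ, ∑ i ∈ Finset.range N, ∫ t in ((i : ℝ) * h + s)..((i : ℝ) * h + h + s), g t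
      = ∫ t in (0 : ℝ)..L, g t := by
    intro s
    have hsum := intervalIntegral.sum_integral_adjacent_intervals
      (a := fun i : ℕ => (i : ℝ) * h + s) (n := N) (f := g) (μ := volume) fun k _ => hint _ _
    have hshift := hper.intervalIntegral_add_eq s 0
    simp only [Nat.cast_add, Nat.cast_one, add_mul, one_mul, Nat.cast_zero, zero_mul, zero_add,
      hN] at hsum hshift
    rw [hsum, add_comm L s, hshift]
  have hsplit : ∀ i : ℕ, ∫ t in ((i : ℝ) * h - 2 * h)..((i : ℝ) * h + 2 * h), g t
      = (∫ t in ((i : ℝ) * h + -2 * h)..((i : ℝ) * h + h + -2 * h), g t)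
        + (∫ t in ((i : ℝ) * h + -h)..((i : ℝ) * h + h + -h), g t)
        + (∫ t in ((i : ℝ) * h + 0)..((i : ℝ) * h + h + 0), g t)
        + ∫ t in ((i : ℝ) * h + h)..((i : ℝ) * h + h + h), g t := by
    intro i
    rw [show (i : ℝ) * h + h + -2 * h = (i : ℝ) * h + -h by ring,
      show (i : ℝ) * h + h + -h = (i : ℝ) * h + 0 by ring,
      show (i : ℝ) * h + h + 0 = (i : ℝ) * h + h by ring,
      intervalIntegral.integral_add_adjacent_intervals (hint _ _) (hint _ _),
      intervalIntegral.integral_add_adjacent_intervals (hint _ _) (hint _ _),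
      intervalIntegral.integral_add_adjacent_intervals (hint _ _) (hint _ _)]
    congr 1 <;> ring
  simp_rw [hsplit, Finset.sum_add_distrib, hcell]
  ring

/-- Discrete ℓ² truncation error estimate for the long stencil fourth order
finite difference approximation of the second derivative, for `C⁶` periodic
test functions. -/
theorem long_stencil_second_deriv_truncation_l2 :
    ∃ C : ℝ, 0 < C ∧
      ∀ (L : ℝ) (Nstar : ℕ), 0 < L → 0 < Nstar →
        ∀ h : ℝ, h = L / Nstar →
          ∀ f : ℝ → ℝ, ContDiff ℝ 6 f → (∀ x, f (x + L) = f x) →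
            Real.sqrt (h *
                ∑ i ∈ Finset.range Nstar,
                  ((-f (((i : ℝ) - 2) * h) + 16 * f (((i : ℝ) - 1) * h)
                      - 30 * f ((i : ℝ) * h) + 16 * f (((i : ℝ) + 1) * h)
                      - f (((i : ℝ) + 2) * h)) / (12 * h ^ 2)
                    - deriv (deriv f) ((i : ℝ) * h)) ^ 2)
              ≤ C * h ^ 4 *
                Real.sqrt (∫ t in (0 : ℝ)..L, (iteratedDeriv 6 f t) ^ 2) := by
  refine ⟨4 / 15, by norm_num, fun L N hL hN h hh f hf hper => ?_⟩
  have hN' : (0 : ℝ) < N := by exact_mod_cast hN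
  have hpos : 0 < h := hh ▸ div_pos hL hN'
  have hNh : (N : ℝ) * h = L := by rw [hh]; field_simp
  have hcont : Continuous (iteratedDeriv 6 f) := hf.continuous_iteratedDeriv' 6
  have hperiodic : Function.Periodic (fun t => iteratedDeriv 6 f t ^ 2) L := fun t => by
    have ht := Function.Periodic.iteratedDeriv hper 6 t
    simp only [ht]
  refine (Real.sqrt_le_sqrt (y := (4 / 15 * h ^ 4) ^ 2 *
    ∫ t in (0 : ℝ)..L, iteratedDeriv 6 f t ^ 2) ?_).trans_eq ?_
  · calc _ ≤ h * ∑ i ∈ Finset.range N, 4 * h ^ 7 / 225 *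
          ∫ t in ((i : ℝ) * h - 2 * h)..((i : ℝ) * h + 2 * h), iteratedDeriv 6 f t ^ 2 := by
          refine mul_le_mul_of_nonneg_left (Finset.sum_le_sum fun i _ => ?_) hpos.le
          have hpt := abs_long_stencil_sub_deriv_deriv_le hf ((i : ℝ) * h) hpos
          have hcs := sq_intervalIntegral_le_mul_integral_sq hcont.abs
            (show (i : ℝ) * h - 2 * h < (i : ℝ) * h + 2 * h by linarith)
          simp only [sq_abs] at hcs
          rw [sub_mul, sub_mul, add_mul, add_mul, one_mul, ← sq_abs]
          refine (pow_le_pow_left₀ (abs_nonneg _) hpt 2).trans ?_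
          rw [mul_pow]
          refine (mul_le_mul_of_nonneg_left hcs (by positivity)).trans_eq ?_
          ring
      _ = _ := by
          rw [← Finset.mul_sum, sum_integral_window_eq_four_mul (by fun_prop) hperiodic hNh]
          ring
  · rw [Real.sqrt_mul (sq_nonneg _), Real.sqrt_sq (by positivity)]
end

section
/- There is an absolute constant C > 0 with the following property. Let L > 0, let N* be a positive integer, set h = L/N*, and let x_i = i·h. For every L-periodic function f : ℝ → ℝ of class C⁵, the truncation error (τ₁)_i = (f(x_{i−2}) − 8 f(x_{i−1}) + 8 f(x_{i+1}) − f(x_{i+2}))/(12 h) − f'(x_i) satisfies the discrete ℓ² bound ( h · ∑_{i=0}^{N*−1} (τ₁)_i² )^{1/2} ≤ C · h⁴ · ‖f⁽⁵⁾‖_{L²(0,L)}, where f⁽⁵⁾ denotes the fifth derivative of f. -/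
open Real MeasureTheory Finset

/-- Taylor's theorem of order three with the Lagrange remainder, on either side of the base point. -/
lemma exists_taylor_three {f : ℝ → ℝ} (hf : ContDiff ℝ 4 f) {x y : ℝ} (hy : y ≠ 0) :
    ∃ ξ ∈ Set.uIcc x (x + y), f (x + y) = f x + deriv f x * y + iteratedDeriv 2 f x * y ^ 2 / 2
      + iteratedDeriv 3 f x * y ^ 3 / 6 + iteratedDeriv 4 f ξ * y ^ 4 / 24 := by
  have hne : x ≠ x + y := by simpa using hy
  have hu : UniqueDiffOn ℝ (Set.uIcc x (x + y)) := uniqueDiffOn_uIcc hne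
  have hx : x ∈ Set.uIcc x (x + y) := Set.left_mem_uIcc
  have key : ∀ k : ℕ, k ≤ 4 →
      iteratedDerivWithin k f (Set.uIcc x (x + y)) x = iteratedDeriv k f x := fun k hk =>
    iteratedDerivWithin_eq_iteratedDeriv hu
      ((hf.of_le (by exact_mod_cast hk)).contDiffAt) hx
  obtain ⟨ξ, hξ, h⟩ := taylor_mean_remainder_lagrange_iteratedDeriv (n := 3) hne
    ((hf.of_le (by norm_num)).contDiffOn)
  refine ⟨ξ, Set.Ioo_subset_Icc_self hξ, ?_⟩
  simp only [taylorWithinEval_succ, taylor_within_zero_eval, zero_add, Nat.reduceAdd,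
    key 1 (by norm_num), key 2 (by norm_num), key 3 (by norm_num),
    iteratedDeriv_one, add_sub_cancel_left, smul_eq_mul] at h
  norm_num [Nat.factorial] at h
  linarith

/-- The Cauchy-Schwarz inequality against the constant function on an interval. -/
lemma sq_intervalIntegral_le {g : ℝ → ℝ} (hg : Continuous g) {a b : ℝ} (hab : a ≤ b) :
    (∫ t in a..b, g t) ^ 2 ≤ (b - a) * ∫ t in a..b, g t ^ 2 := by
  rcases hab.eq_or_lt with rfl | hlt
  · simp
  set m := ∫ t in a..b, g t with hm
  have hpos : 0 < b - a := sub_pos.2 hlt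
  have h0 : 0 ≤ ∫ t in a..b, ((b - a) * g t - m) ^ 2 :=
    intervalIntegral.integral_nonneg hab fun t _ => sq_nonneg _
  have h1 : ∫ t in a..b, ((b - a) * g t - m) ^ 2
      = (b - a) ^ 2 * (∫ t in a..b, g t ^ 2) - 2 * (b - a) * m * m + (b - a) * m ^ 2 := by
    have : ∀ t, ((b - a) * g t - m) ^ 2
        = (b - a) ^ 2 * g t ^ 2 - 2 * (b - a) * m * g t + m ^ 2 := fun t => by ring
    simp only [this]
    rw [intervalIntegral.integral_add, intervalIntegral.integral_sub,
      intervalIntegral.integral_const_mul, intervalIntegral.integral_const_mul,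
      intervalIntegral.integral_const, ← hm, smul_eq_mul]
    all_goals exact Continuous.intervalIntegrable (by fun_prop) _ _
  rw [h1] at h0
  have h2 : 0 ≤ (b - a) * ((b - a) * (∫ t in a..b, g t ^ 2) - m ^ 2) := by linarith
  linarith [nonneg_of_mul_nonneg_right h2 hpos]

/-- The oscillation of a `C¹` function over an interval is controlled by the `L²` norm of its
derivative. -/
lemma sq_sub_le_integral_sq_deriv {F : ℝ → ℝ} (hF : ContDiff ℝ 1 F) {a b p q : ℝ}
    (hp : p ∈ Set.Icc a b) (hq : q ∈ Set.Icc a b) :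
    (F q - F p) ^ 2 ≤ (b - a) * ∫ t in a..b, deriv F t ^ 2 := by
  wlog hpq : p ≤ q generalizing p q
  · rw [← neg_sub, neg_sq]
    exact this hq hp (le_of_not_ge hpq)
  have hc : Continuous (deriv F) := hF.continuous_deriv le_rfl
  have hFTC : ∫ t in p..q, deriv F t = F q - F p :=
    intervalIntegral.integral_deriv_eq_sub (fun t _ => (hF.differentiable one_ne_zero) t)
      (hc.intervalIntegrable _ _)
  have hmono : ∫ t in p..q, deriv F t ^ 2 ≤ ∫ t in a..b, deriv F t ^ 2 :=
    intervalIntegral.integral_mono_interval hp.1 hpq hq.2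
      (Filter.Eventually.of_forall fun t => sq_nonneg _)
      ((hc.pow 2).intervalIntegrable _ _)
  rw [← hFTC]
  refine (sq_intervalIntegral_le hc hpq).trans ?_
  have := intervalIntegral.integral_nonneg (μ := volume) hpq fun t _ => sq_nonneg (deriv F t)
  exact mul_le_mul (by linarith [hp.1, hq.2]) hmono this (by linarith [hp.1, hq.2])

/-- Pointwise bound for the truncation error of the long stencil difference. -/
lemma sq_long_stencil_error_le {f : ℝ → ℝ} (hf : ContDiff ℝ 5 f) (x : ℝ) {h : ℝ} (hh : 0 < h) :
    ((f (x - 2 * h) - 8 * f (x - h) + 8 * f (x + h) - f (x + 2 * h)) / (12 * h)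
      - deriv f x) ^ 2
      ≤ h ^ 7 / 36 * ∫ t in (x - 2 * h)..(x + 2 * h), iteratedDeriv 5 f t ^ 2 := by
  have hf4 : ContDiff ℝ 4 f := hf.of_le (by norm_num)
  have hF : ContDiff ℝ 1 (iteratedDeriv 4 f) := by
    rw [iteratedDeriv_eq_iterate]
    exact ContDiff.iterate_deriv' 1 4 hf
  have hmem : ∀ {y ξ : ℝ}, |y| ≤ 2 * h → ξ ∈ Set.uIcc x (x + y) →
      ξ ∈ Set.Icc (x - 2 * h) (x + 2 * h) := fun {y ξ} hy hξ => by
    obtain ⟨h1, h2⟩ := abs_le.1 hy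
    exact Set.uIcc_subset_Icc ⟨by linarith, by linarith⟩ ⟨by linarith, by linarith⟩ hξ
  have h2h : |2 * h| ≤ 2 * h := (abs_of_pos (by positivity)).le
  have h1h : |h| ≤ 2 * h := by rw [abs_of_pos hh]; linarith
  obtain ⟨a, ha, ea⟩ := exists_taylor_three hf4 (x := x) (y := -(2 * h)) (by simp [hh.ne'])
  obtain ⟨b, hb, eb⟩ := exists_taylor_three hf4 (x := x) (y := -h) (by simp [hh.ne'])
  obtain ⟨c, hc, ec⟩ := exists_taylor_three hf4 (x := x) (y := h) hh.ne'
  obtain ⟨d, hd, ed⟩ := exists_taylor_three hf4 (x := x) (y := 2 * h) (by simp [hh.ne'])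
  have had := sq_sub_le_integral_sq_deriv hF (hmem h2h hd) (hmem (by rwa [abs_neg]) ha)
  have hbc := sq_sub_le_integral_sq_deriv hF (hmem (by rwa [abs_neg]) hb) (hmem h1h hc)
  rw [← iteratedDeriv_succ] at had hbc
  have herr : (f (x - 2 * h) - 8 * f (x - h) + 8 * f (x + h) - f (x + 2 * h)) / (12 * h)
      - deriv f x = h ^ 3 / 36 * (2 * (iteratedDeriv 4 f a - iteratedDeriv 4 f d)
        + (iteratedDeriv 4 f c - iteratedDeriv 4 f b)) := by
    rw [sub_eq_add_neg x, sub_eq_add_neg x, ea, eb, ec, ed]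
    field_simp
    ring
  rw [herr, mul_pow]
  set u := iteratedDeriv 4 f a - iteratedDeriv 4 f d
  set v := iteratedDeriv 4 f c - iteratedDeriv 4 f b
  set I := ∫ t in (x - 2 * h)..(x + 2 * h), iteratedDeriv 5 f t ^ 2
  have huv : (2 * u + v) ^ 2 ≤ 9 * (4 * h * I) := by
    norm_num at had hbc
    nlinarith [sq_nonneg (u - v)]
  calc (h ^ 3 / 36) ^ 2 * (2 * u + v) ^ 2 ≤ (h ^ 3 / 36) ^ 2 * (9 * (4 * h * I)) := by gcongr
    _ = h ^ 7 / 36 * I := by ring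

/-- Over a full period, the cells of a uniform grid, shifted by any amount, add up to the integral
over the period. -/
lemma sum_integral_cells_eq {g : ℝ → ℝ} (hg : Continuous g) {h : ℝ} (N : ℕ)
    (hper : Function.Periodic g (N * h)) (s : ℝ) :
    ∑ i ∈ range N, ∫ t in (i * h + s)..(i * h + s + h), g t = ∫ t in (0 : ℝ)..(N * h), g t := by
  have := intervalIntegral.sum_integral_adjacent_intervals (f := g) (μ := volume) (n := N)
    (a := fun k : ℕ => k * h + s) fun k _ => hg.intervalIntegrable _ _
  have hcell : ∀ i : ℕ, ((i + 1 : ℕ) : ℝ) * h + s = i * h + s + h := fun i => by push_cast; ring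
  simp only [hcell] at this
  rw [this, show (N : ℝ) * h + s = (((0 : ℕ) : ℝ) * h + s) + N * h by simp [add_comm],
    hper.intervalIntegral_add_eq _ 0, zero_add]

lemma sum_integral_window_eq {g : ℝ → ℝ} (hg : Continuous g) {h : ℝ} (N : ℕ)
    (hper : Function.Periodic g (N * h)) :
    ∑ i ∈ range N, ∫ t in (i * h - 2 * h)..(i * h + 2 * h), g t
      = 4 * ∫ t in (0 : ℝ)..(N * h), g t := by
  have hsplit : ∀ x : ℝ, ∫ t in (x - 2 * h)..(x + 2 * h), g t
      = (∫ t in (x + -(2 * h))..(x + -(2 * h) + h), g t) + (∫ t in (x + -h)..(x + -h + h), g t)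
        + (∫ t in (x + 0)..(x + 0 + h), g t) + ∫ t in (x + h)..(x + h + h), g t := fun x => by
    have hi : ∀ a b, IntervalIntegrable g volume a b := fun a b => hg.intervalIntegrable a b
    rw [show x + -(2 * h) + h = x + -h by ring, show x + -h + h = x + 0 by ring,
      show x + 0 + h = x + h by ring,
      intervalIntegral.integral_add_adjacent_intervals (hi _ _) (hi _ _),
      intervalIntegral.integral_add_adjacent_intervals (hi _ _) (hi _ _),
      intervalIntegral.integral_add_adjacent_intervals (hi _ _) (hi _ _)]
    congr 1
    ring
  simp only [hsplit, sum_add_distrib, sum_integral_cells_eq hg N hper]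
  ring

/-- Discrete ℓ² truncation error estimate for the long stencil fourth order
finite difference approximation of the first derivative, for `C⁵` periodic
test functions. -/
theorem long_stencil_first_deriv_truncation_l2 :
    ∃ C : ℝ, 0 < C ∧
      ∀ (L : ℝ) (Nstar : ℕ), 0 < L → 0 < Nstar →
        ∀ h : ℝ, h = L / Nstar →
          ∀ f : ℝ → ℝ, ContDiff ℝ 5 f → (∀ x, f (x + L) = f x) →
            Real.sqrt (h *
                ∑ i ∈ Finset.range Nstar,
                  ((f (((i : ℝ) - 2) * h) - 8 * f (((i : ℝ) - 1) * h)
                      + 8 * f (((i : ℝ) + 1) * h)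
                      - f (((i : ℝ) + 2) * h)) / (12 * h)
                    - deriv f ((i : ℝ) * h)) ^ 2)
              ≤ C * h ^ 4 *
                Real.sqrt (∫ t in (0 : ℝ)..L, (iteratedDeriv 5 f t) ^ 2) := by
  refine ⟨1 / 3, by norm_num, fun L N hL hN h hh f hf hper => ?_⟩
  have hN' : (0 : ℝ) < N := by exact_mod_cast hN
  have hpos : 0 < h := hh ▸ div_pos hL hN'
  have hNh : (N : ℝ) * h = L := by rw [hh]; field_simp
  have hcont : Continuous fun t => iteratedDeriv 5 f t ^ 2 :=
    (hf.continuous_iteratedDeriv' 5).pow 2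
  have hper5 : Function.Periodic (fun t => iteratedDeriv 5 f t ^ 2) (N * h) := fun t => by
    have hfL : (fun x => f (x + L)) = f := funext hper
    have := congrFun (iteratedDeriv_comp_add_const 5 f L) t
    rw [hfL] at this
    simp only [hNh, this]
  have hsum := sum_integral_window_eq hcont N hper5
  rw [hNh] at hsum
  refine Real.sqrt_le_iff.2 ⟨by positivity, ?_⟩
  rw [mul_pow, Real.sq_sqrt (intervalIntegral.integral_nonneg hL.le fun t _ => sq_nonneg _)]
  calc _ ≤ h * ∑ i ∈ range N, h ^ 7 / 36 *
        ∫ t in (i * h - 2 * h)..(i * h + 2 * h), iteratedDeriv 5 f t ^ 2 := by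
        gcongr with i hi
        simpa only [sub_mul, add_mul, one_mul] using sq_long_stencil_error_le hf (i * h) hpos
    _ = (1 / 3 * h ^ 4) ^ 2 * ∫ t in (0 : ℝ)..L, iteratedDeriv 5 f t ^ 2 := by
        rw [← mul_sum, hsum]
        ring
end

section
/- Let L > 0. There exists a constant C > 0, depending only on L, with the following property. For every positive integer N, with N* = 2N+1 and h = L/N*, and every smooth (C^∞) function f : ℝ² → ℝ that is L-periodic in each variable, the truncation error τ_{i,j} = (Δ_{h,(4)} f)(x_i, y_j) − (Δ f)(x_i, y_j) at the grid points (x_i, y_j) = (i·h, j·h) satisfies ( h² ∑_{i,j=0}^{N*−1} τ_{i,j}² )^{1/2} ≤ C · h⁴ · ‖f‖_{H⁶(Ω)}, where Ω = (0,L)² and ‖f‖_{H⁶(Ω)}² = ∑_{|α|≤6} ‖∂^α f‖²_{L²(Ω)}. -/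
open Real MeasureTheory Finset

/-- Mixed partial derivative `∂_x^a ∂_y^b f` of a function of two real variables. -/
noncomputable def partialDeriv2D (a b : ℕ) (f : ℝ → ℝ → ℝ) (x y : ℝ) : ℝ :=
  iteratedDeriv a (fun s => iteratedDeriv b (f s) y) x

/-- Squared `H⁶` norm of `f` on `Ω = (0,L)²`: the sum of the squared `L²` norms of
all partial derivatives `∂^α f` with `|α| ≤ 6`. -/
noncomputable def H6normSq2D (L : ℝ) (f : ℝ → ℝ → ℝ) : ℝ :=
  ∑ a ∈ Finset.range 7, ∑ b ∈ Finset.range (7 - a),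
    ∫ x in (0 : ℝ)..L, ∫ y in (0 : ℝ)..L, (partialDeriv2D a b f x y) ^ 2

/-- The 2-D long stencil fourth order discrete Laplacian `Δ_{h,(4)} = D²_{x,(4)} + D²_{y,(4)}`. -/
noncomputable def discLap4_2D (h : ℝ) (f : ℝ → ℝ → ℝ) (x y : ℝ) : ℝ :=
  (-f (x - 2 * h) y + 16 * f (x - h) y - 30 * f x y + 16 * f (x + h) y - f (x + 2 * h) y)
      / (12 * h ^ 2)
    + (-f x (y - 2 * h) + 16 * f x (y - h) - 30 * f x y + 16 * f x (y + h) - f x (y + 2 * h))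
      / (12 * h ^ 2)

/-- The continuous Laplacian `Δ f = ∂²_x f + ∂²_y f`. -/
noncomputable def contLap2D (f : ℝ → ℝ → ℝ) (x y : ℝ) : ℝ :=
  deriv (deriv (fun s => f s y)) x + deriv (deriv (f x)) y

/-- Cauchy–Schwarz against the constant function on an interval. -/
theorem sq_integral_abs_le {a b : ℝ} (hab : a < b) {w : ℝ → ℝ} (hw : Continuous w) :
    (∫ s in a..b, |w s|) ^ 2 ≤ (b - a) * ∫ s in a..b, w s ^ 2 := by
  set m := ∫ s in a..b, |w s| with hm
  have hnonneg : 0 ≤ ∫ s in a..b, ((b - a) * |w s| - m) ^ 2 :=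
    intervalIntegral.integral_nonneg hab.le fun _ _ => sq_nonneg _
  have hexpand : ∫ s in a..b, ((b - a) * |w s| - m) ^ 2
      = (b - a) ^ 2 * (∫ s in a..b, w s ^ 2) - 2 * (b - a) * m * m + (b - a) * m ^ 2 := by
    have hpt : ∀ s, ((b - a) * |w s| - m) ^ 2
        = (b - a) ^ 2 * w s ^ 2 - 2 * (b - a) * m * |w s| + m ^ 2 := fun s => by
      rw [← sq_abs (w s)]; ring
    simp_rw [hpt]
    have h1 : Continuous fun s => (b - a) ^ 2 * w s ^ 2 := by fun_prop
    have h2 : Continuous fun s => 2 * (b - a) * m * |w s| := by fun_prop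
    rw [intervalIntegral.integral_add ((show Continuous fun s => (b - a) ^ 2 * w s ^ 2 - 2 * (b - a) * m * |w s|
        from h1.sub h2).intervalIntegrable _ _) (by simp),
      intervalIntegral.integral_sub (h1.intervalIntegrable _ _) (h2.intervalIntegrable _ _),
      intervalIntegral.integral_const_mul, intervalIntegral.integral_const_mul, ← hm]
    simp
  rw [hexpand] at hnonneg
  have hpos : 0 < b - a := sub_pos.2 hab
  have : 0 ≤ (b - a) * ((b - a) * (∫ s in a..b, w s ^ 2) - m ^ 2) := by linarith
  linarith [nonneg_of_mul_nonneg_right this hpos]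

theorem abs_sub_le_integral_abs_deriv {u u' : ℝ → ℝ} (hu : ∀ s, HasDerivAt u (u' s) s)
    (hu' : Continuous u') {a b x y : ℝ} (hx : x ∈ Set.Icc a b) (hy : y ∈ Set.Icc a b) :
    |u y - u x| ≤ ∫ s in a..b, |u' s| := by
  have hab : a ≤ b := hx.1.trans hx.2
  rw [← intervalIntegral.integral_eq_sub_of_hasDerivAt (fun s _ => hu s)
    (hu'.intervalIntegrable _ _)]
  refine (intervalIntegral.norm_integral_le_abs_integral_norm
    (f := u') (μ := volume)).trans ?_
  have hsub : Set.uIoc x y ⊆ Set.uIoc a b :=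
    Set.uIoc_subset_uIoc_of_uIcc_subset_uIcc <|
      Set.uIcc_subset_uIcc (by rwa [Set.uIcc_of_le hab]) (by rwa [Set.uIcc_of_le hab])
  refine (intervalIntegral.abs_integral_mono_interval hsub
    (Filter.Eventually.of_forall fun _ => norm_nonneg _)
    (hu'.norm.intervalIntegrable _ _)).trans_eq ?_
  exact abs_of_nonneg (intervalIntegral.integral_nonneg hab fun _ _ => norm_nonneg _)

/-- Taylor's formula, with the remainder controlled by the `L¹` norm of the last derivative. -/
theorem abs_taylor_remainder_le (m : ℕ) : ∀ {u : ℝ → ℝ}, ContDiff ℝ (⊤ : ℕ∞) u →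
    ∀ {x r t : ℝ}, |t| ≤ r →
      |u (x + t) - ∑ k ∈ Finset.range (m + 1), iteratedDeriv k u x * t ^ k / (k.factorial : ℝ)|
        ≤ |t| ^ m * ∫ s in (x - r)..(x + r), |iteratedDeriv (m + 1) u s| := by
  induction m with
  | zero =>
    intro u hu x r t ht
    have hr : 0 ≤ r := (abs_nonneg t).trans ht
    rw [abs_le] at ht
    have hd : ∀ s, HasDerivAt u (deriv u s) s := fun s =>
      (hu.differentiable (by simp)).differentiableAt.hasDerivAt
    simpa using abs_sub_le_integral_abs_deriv hd (hu.continuous_deriv (by simp))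
      (a := x - r) (b := x + r) (x := x) (y := x + t)
      ⟨by linarith, by linarith⟩ ⟨by linarith, by linarith⟩
  | succ m ih =>
    intro u hu x r t ht
    have hu' : ContDiff ℝ (⊤ : ℕ∞) (deriv u) := (contDiff_infty_iff_deriv.1 hu).2
    have hd : ∀ s, HasDerivAt u (deriv u s) s := fun s =>
      (hu.differentiable (by simp)).differentiableAt.hasDerivAt
    set φ : ℝ → ℝ := fun s =>
      u (x + s) - ∑ k ∈ Finset.range (m + 2), iteratedDeriv k u x * s ^ k / (k.factorial : ℝ)
      with hφ
    set φ' : ℝ → ℝ := fun s => deriv u (x + s)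
      - ∑ k ∈ Finset.range (m + 1), iteratedDeriv k (deriv u) x * s ^ k / (k.factorial : ℝ)
      with hφ'
    have hφd : ∀ s, HasDerivAt φ (φ' s) s := by
      intro s
      have hsum : HasDerivAt (fun s => ∑ k ∈ Finset.range (m + 2),
          iteratedDeriv k u x * s ^ k / (k.factorial : ℝ))
          (∑ k ∈ Finset.range (m + 2),
            iteratedDeriv k u x * (k * s ^ (k - 1)) / (k.factorial : ℝ)) s :=
        HasDerivAt.fun_sum fun k _ => ((hasDerivAt_pow k s).const_mul _).div_const _
      refine (((hd (x + s)).comp_const_add x s).sub hsum).congr_deriv ?_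
      rw [Finset.sum_range_succ']
      simp only [hφ', Nat.cast_zero, zero_mul, mul_zero, zero_div, add_zero]
      congr 1
      refine Finset.sum_congr rfl fun k _ => ?_
      rw [iteratedDeriv_succ', Nat.factorial_succ, Nat.add_sub_cancel]
      have : (k.factorial : ℝ) ≠ 0 := by positivity
      push_cast
      field_simp
    have hφ0 : φ 0 = 0 := by
      simp [hφ, Finset.sum_range_succ']
    set I := ∫ s in (x - r)..(x + r), |iteratedDeriv (m + 2) u s| with hI
    have hInn : 0 ≤ I := intervalIntegral.integral_nonneg
      (by linarith [abs_nonneg t]) fun _ _ => abs_nonneg _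
    have hbound : ∀ s ∈ Set.Icc (-|t|) |t|, ‖φ' s‖ ≤ |t| ^ m * I := by
      intro s hs
      have hst : |s| ≤ |t| := abs_le.2 hs
      have := ih hu' (x := x) (hst.trans ht)
      rw [← iteratedDeriv_succ'] at this
      exact this.trans (mul_le_mul_of_nonneg_right (pow_le_pow_left₀ (abs_nonneg _) hst m) hInn)
    have key := Convex.norm_image_sub_le_of_norm_hasDerivWithin_le (f := φ) (f' := φ')
      (fun s _ => (hφd s).hasDerivWithinAt) hbound (convex_Icc _ _)
      (x := 0) (y := t) ⟨by simp, abs_nonneg t⟩ ⟨neg_abs_le t, le_abs_self t⟩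
    rw [hφ0, sub_zero, sub_zero, Real.norm_eq_abs, Real.norm_eq_abs] at key
    calc |φ t| ≤ |t| ^ m * I * |t| := key
      _ = |t| ^ (m + 1) * I := by ring

/-- The pointwise error of the long stencil approximation of the second derivative. -/
noncomputable def stencilError (h : ℝ) (u : ℝ → ℝ) (x : ℝ) : ℝ :=
  (-u (x - 2 * h) + 16 * u (x - h) - 30 * u x + 16 * u (x + h) - u (x + 2 * h)) / (12 * h ^ 2)
    - deriv (deriv u) x

theorem sq_stencilError_le {m : ℕ} (hm : m = 4 ∨ m = 5) {u : ℝ → ℝ}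
    (hu : ContDiff ℝ (⊤ : ℕ∞) u) {h : ℝ} (hh : 0 < h) (x : ℝ) :
    h ^ 4 * stencilError h u x ^ 2
      ≤ 256 * h ^ (2 * m + 1) *
        ∫ s in (x - 2 * h)..(x + 2 * h), iteratedDeriv (m + 1) u s ^ 2 := by
  set I := ∫ s in (x - 2 * h)..(x + 2 * h), |iteratedDeriv (m + 1) u s| with hI
  have hcs := sq_integral_abs_le (show x - 2 * h < x + 2 * h by linarith)
    (hu.continuous_iteratedDeriv (m + 1) (by exact_mod_cast le_top))
  have hlin : |12 * h ^ 2 * stencilError h u x| ≤ 96 * (h ^ m * I) := by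
    have habs : |h| = h := abs_of_pos hh
    have habs2 : |2 * h| = 2 * h := abs_of_pos (by linarith)
    have r1 := abs_taylor_remainder_le m hu (x := x) (r := 2 * h) (t := h) (by rw [habs]; linarith)
    have r2 := abs_taylor_remainder_le m hu (x := x) (r := 2 * h) (t := -h)
      (by rw [abs_neg, habs]; linarith)
    have r3 := abs_taylor_remainder_le m hu (x := x) (r := 2 * h) (t := 2 * h) habs2.le
    have r4 := abs_taylor_remainder_le m hu (x := x) (r := 2 * h) (t := -(2 * h))
      (by rw [abs_neg, habs2])
    rw [← hI] at r1 r2 r3 r4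
    rw [abs_neg] at r2 r4
    rw [habs] at r1 r2
    rw [habs2, mul_pow, mul_assoc] at r3 r4
    have hInn : 0 ≤ h ^ m * I := mul_nonneg (by positivity)
      (intervalIntegral.integral_nonneg (by linarith) fun _ _ => abs_nonneg _)
    have herr : 12 * h ^ 2 * stencilError h u x
        = -u (x + -(2 * h)) + 16 * u (x + -h) - 30 * u x + 16 * u (x + h) - u (x + 2 * h)
          - 12 * h ^ 2 * iteratedDeriv 2 u x := by
      rw [stencilError, iteratedDeriv_succ, iteratedDeriv_one, ← sub_eq_add_neg x,
        ← sub_eq_add_neg x]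
      field_simp
    rw [herr]
    rw [abs_le] at r1 r2 r3 r4 ⊢
    rcases hm with rfl | rfl <;>
    · norm_num [Finset.sum_range_succ, Nat.factorial, iteratedDeriv_zero] at r1 r2 r3 r4 ⊢
      constructor <;> linarith
  have hsq : (12 * h ^ 2 * stencilError h u x) ^ 2 ≤ (96 * (h ^ m * I)) ^ 2 :=
    sq_le_sq' (abs_le.1 hlin).1 (abs_le.1 hlin).2
  have hcs' := mul_le_mul_of_nonneg_left hcs (show 0 ≤ 64 * h ^ (2 * m) by positivity)
  calc h ^ 4 * stencilError h u x ^ 2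
      = (12 * h ^ 2 * stencilError h u x) ^ 2 / 144 := by ring
    _ ≤ (96 * (h ^ m * I)) ^ 2 / 144 := by gcongr
    _ = 64 * h ^ (2 * m) * I ^ 2 := by ring
    _ ≤ _ := hcs'
    _ = _ := by ring

theorem sum_integral_translated_cells {w : ℝ → ℝ} (hw : Continuous w) {L h : ℝ} {M : ℕ}
    (hM : M * h = L) (hper : Function.Periodic w L) (c : ℝ) :
    ∑ i ∈ Finset.range M, ∫ s in (i * h + c)..(i * h + c + h), w s = ∫ s in (0 : ℝ)..L, w s := by
  have := intervalIntegral.sum_integral_adjacent_intervals (f := w) (μ := volume)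
    (a := fun i : ℕ => i * h + c) (n := M) fun _ _ => hw.intervalIntegrable _ _
  calc _ = ∑ i ∈ Finset.range M, ∫ s in (i * h + c)..(((i + 1 : ℕ) : ℝ) * h + c), w s := by
        refine Finset.sum_congr rfl fun i _ => ?_
        congr 1
        push_cast
        ring
    _ = ∫ s in c..(c + L), w s := by
        rw [this]
        congr 1
        · simp
        · rw [hM, add_comm]
    _ = _ := by simpa using hper.intervalIntegral_add_eq c 0

theorem sum_integral_stencil {w : ℝ → ℝ} (hw : Continuous w) {L h : ℝ} {M : ℕ}
    (hM : M * h = L) (hper : Function.Periodic w L) :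
    ∑ i ∈ Finset.range M, ∫ s in (i * h - 2 * h)..(i * h + 2 * h), w s
      = 4 * ∫ s in (0 : ℝ)..L, w s := by
  have hint : ∀ a b, IntervalIntegrable w volume a b := fun a b => hw.intervalIntegrable a b
  have hsplit : ∀ i : ℕ, ∫ s in (i * h - 2 * h)..(i * h + 2 * h), w s
      = (∫ s in (i * h + -2 * h)..(i * h + -2 * h + h), w s)
        + (∫ s in (i * h + -h)..(i * h + -h + h), w s)
        + (∫ s in (i * h + 0)..(i * h + 0 + h), w s)
        + ∫ s in (i * h + h)..(i * h + h + h), w s := by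
    intro i
    rw [show i * h + -2 * h + h = i * h + -h by ring, show i * h + -h + h = i * h + 0 by ring,
      show i * h + 0 + h = i * h + h by ring, show i * h + h + h = i * h + 2 * h by ring,
      show i * h + -2 * h = i * h - 2 * h by ring,
      intervalIntegral.integral_add_adjacent_intervals (hint _ _) (hint _ _),
      intervalIntegral.integral_add_adjacent_intervals (hint _ _) (hint _ _),
      intervalIntegral.integral_add_adjacent_intervals (hint _ _) (hint _ _)]
  simp_rw [hsplit, Finset.sum_add_distrib, sum_integral_translated_cells hw hM hper]
  ring

theorem sum_sq_stencilError_le {m : ℕ} (hm : m = 4 ∨ m = 5) {u : ℝ → ℝ}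
    (hu : ContDiff ℝ (⊤ : ℕ∞) u) {L h : ℝ} {M : ℕ} (hh : 0 < h) (hM : M * h = L)
    (hper : Function.Periodic u L) :
    h ^ 4 * ∑ i ∈ Finset.range M, stencilError h u (i * h) ^ 2
      ≤ 1024 * h ^ (2 * m + 1) * ∫ s in (0 : ℝ)..L, iteratedDeriv (m + 1) u s ^ 2 := by
  have hper' : Function.Periodic (fun s => iteratedDeriv (m + 1) u s ^ 2) L := fun s => by
    have := congrFun (iteratedDeriv_comp_add_const (m + 1) u L) s
    simp only [← this]
    rw [show (fun z => u (z + L)) = u from funext hper]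
  have hcont : Continuous fun s => iteratedDeriv (m + 1) u s ^ 2 :=
    (hu.continuous_iteratedDeriv (m + 1) (by exact_mod_cast le_top)).pow 2
  rw [Finset.mul_sum]
  refine (Finset.sum_le_sum fun (i : ℕ) _ => sq_stencilError_le hm hu hh (i * h)).trans_eq ?_
  rw [← Finset.mul_sum, sum_integral_stencil hcont hM hper']
  ring

/-- Discrete Sobolev bound of the grid samples of a function by its `H¹` norm. -/
theorem sum_sq_samples_le {g g' : ℝ → ℝ} (hg : ∀ s, HasDerivAt g (g' s) s)
    (hg' : Continuous g') {L h : ℝ} {M : ℕ} (hh : 0 < h) (hM : M * h = L) :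
    h * ∑ j ∈ Finset.range M, g (j * h) ^ 2
      ≤ 2 * (∫ y in (0 : ℝ)..L, g y ^ 2) + 2 * h ^ 2 * ∫ y in (0 : ℝ)..L, g' y ^ 2 := by
  have hgc : Continuous g := continuous_iff_continuousAt.2 fun s => (hg s).continuousAt
  have cells : ∀ w : ℝ → ℝ, Continuous w →
      ∑ j ∈ Finset.range M, ∫ y in (j * h)..((j + 1 : ℕ) * h), w y = ∫ y in (0 : ℝ)..L, w y := by
    intro w hw
    have := intervalIntegral.sum_integral_adjacent_intervals (f := w) (μ := volume)
      (a := fun j : ℕ => j * h) (n := M) fun _ _ => hw.intervalIntegrable _ _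
    rw [this, hM]
    simp
  rw [← cells (fun y => g y ^ 2) (hgc.pow 2), ← cells (fun y => g' y ^ 2) (hg'.pow 2), Finset.mul_sum, Finset.mul_sum,
    Finset.mul_sum, ← Finset.sum_add_distrib]
  refine Finset.sum_le_sum fun j _ => ?_
  set a := j * h
  have hb : ((j + 1 : ℕ) : ℝ) * h = a + h := by push_cast; ring
  rw [hb]
  set J := ∫ y in a..(a + h), g' y ^ 2
  have hpt : ∀ y ∈ Set.Icc a (a + h), g a ^ 2 ≤ 2 * g y ^ 2 + 2 * h * J := by
    intro y hy
    have h1 := abs_sub_le_integral_abs_deriv hg hg' hy ⟨le_rfl, by linarith⟩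
    have h2 := sq_integral_abs_le (show a < a + h by linarith) hg'
    have h3 : (g a - g y) ^ 2 ≤ h * J := by
      rw [← sq_abs]
      refine (pow_le_pow_left₀ (abs_nonneg _) h1 2).trans (h2.trans_eq ?_)
      rw [add_sub_cancel_left]
    linarith [sq_nonneg (g a - 2 * g y)]
  have hc : Continuous fun y => 2 * g y ^ 2 := by fun_prop
  have hmono := intervalIntegral.integral_mono_on (show a ≤ a + h by linarith)
    (continuous_const.intervalIntegrable (μ := volume) _ _)
    ((show Continuous fun y => 2 * g y ^ 2 + 2 * h * J from
      hc.add continuous_const).intervalIntegrable _ _) hpt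
  rw [intervalIntegral.integral_add (hc.intervalIntegrable _ _) (by simp),
    intervalIntegral.integral_const_mul] at hmono
  simp only [intervalIntegral.integral_const, add_sub_cancel_left, smul_eq_mul] at hmono
  linarith

/-- The partial derivative in the first variable. -/
noncomputable def partialX (f : ℝ → ℝ → ℝ) : ℝ → ℝ → ℝ := fun x y => deriv (fun s => f s y) x

/-- The partial derivative in the second variable. -/
noncomputable def partialY (f : ℝ → ℝ → ℝ) : ℝ → ℝ → ℝ := fun x y => deriv (f x) y

/-- Joint smoothness of a curried function of two real variables. -/
abbrev Smooth2D (f : ℝ → ℝ → ℝ) : Prop := ContDiff ℝ (⊤ : ℕ∞) fun p : ℝ × ℝ => f p.1 p.2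

namespace Smooth2D

variable {f : ℝ → ℝ → ℝ}

theorem swap (hf : Smooth2D f) : Smooth2D (Function.swap f) :=
  hf.comp (contDiff_snd.prodMk contDiff_fst)

theorem contDiff_left (hf : Smooth2D f) (y : ℝ) : ContDiff ℝ (⊤ : ℕ∞) fun s => f s y :=
  hf.comp (contDiff_id.prodMk contDiff_const)

theorem contDiff_right (hf : Smooth2D f) (x : ℝ) : ContDiff ℝ (⊤ : ℕ∞) (f x) :=
  hf.swap.contDiff_left x

theorem partialX_eq_fderiv (hf : Smooth2D f) (x y : ℝ) :
    partialX f x y = fderiv ℝ (fun p : ℝ × ℝ => f p.1 p.2) (x, y) (1, 0) :=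
  (HasFDerivAt.comp_hasDerivAt (f := fun s => (s, y)) x (hf.differentiable (by simp) (x, y)).hasFDerivAt
    ((hasDerivAt_id x).prodMk (hasDerivAt_const x y))).deriv

theorem partialY_eq_fderiv (hf : Smooth2D f) (x y : ℝ) :
    partialY f x y = fderiv ℝ (fun p : ℝ × ℝ => f p.1 p.2) (x, y) (0, 1) :=
  (HasFDerivAt.comp_hasDerivAt (f := fun s => (x, s)) y (hf.differentiable (by simp) (x, y)).hasFDerivAt
    ((hasDerivAt_const y x).prodMk (hasDerivAt_id y))).deriv

theorem contDiff_fderiv (hf : Smooth2D f) :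
    ContDiff ℝ (⊤ : ℕ∞) (fderiv ℝ fun p : ℝ × ℝ => f p.1 p.2) :=
  hf.fderiv_right (by simp)

theorem partialX (hf : Smooth2D f) : Smooth2D (partialX f) := by
  simpa only [Smooth2D, hf.partialX_eq_fderiv] using hf.contDiff_fderiv.clm_apply contDiff_const

theorem partialY (hf : Smooth2D f) : Smooth2D (partialY f) :=
  hf.swap.partialX.swap

theorem iterate_partialX (hf : Smooth2D f) (n : ℕ) : Smooth2D (_root_.partialX^[n] f) := by
  induction n with
  | zero => exact hf
  | succ n ih => rw [Function.iterate_succ_apply']; exact ih.partialX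

theorem partialY_partialX (hf : Smooth2D f) :
    _root_.partialY (_root_.partialX f) = _root_.partialX (_root_.partialY f) := by
  funext x y
  have hd : DifferentiableAt ℝ (fderiv ℝ fun p : ℝ × ℝ => f p.1 p.2) (x, y) :=
    hf.contDiff_fderiv.differentiable (by simp) _
  have hsymm : IsSymmSndFDerivAt ℝ (fun p : ℝ × ℝ => f p.1 p.2) (x, y) :=
    (contDiff_infty.1 hf 2).contDiffAt.isSymmSndFDerivAt (by simp)
  rw [hf.partialX.partialY_eq_fderiv, hf.partialY.partialX_eq_fderiv]
  simp_rw [hf.partialX_eq_fderiv, hf.partialY_eq_fderiv, Prod.mk.eta]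
  rw [fderiv_clm_apply hd (differentiableAt_const _),
    fderiv_clm_apply hd (differentiableAt_const _)]
  simpa using hsymm (0, 1) (1, 0)

theorem iterate_partialY_partialX (hf : Smooth2D f) (n : ℕ) :
    _root_.partialY^[n] (_root_.partialX f) = _root_.partialX (_root_.partialY^[n] f) := by
  induction n generalizing f with
  | zero => rfl
  | succ n ih =>
    rw [Function.iterate_succ_apply, hf.partialY_partialX, ih hf.partialY,
      Function.iterate_succ_apply]

theorem hasDerivAt_right (hf : Smooth2D f) (x y : ℝ) :
    HasDerivAt (f x) (_root_.partialY f x y) y :=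
  ((hf.contDiff_right x).differentiable (by simp)).differentiableAt.hasDerivAt

theorem continuous_stencilError (hf : Smooth2D f) (h x : ℝ) :
    Continuous fun y => stencilError h (fun s => f s y) x := by
  have hc : ∀ c, Continuous (f c) := fun c => (hf.contDiff_right c).continuous
  have hcc : Continuous fun y => deriv (deriv fun s => f s y) x :=
    (hf.partialX.partialX.contDiff_right x).continuous
  unfold stencilError
  have := hc (x - 2 * h)
  have := hc (x - h)
  have := hc x
  have := hc (x + h)
  have := hc (x + 2 * h)
  fun_prop

theorem hasDerivAt_stencilError (hf : Smooth2D f) (h x y : ℝ) :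
    HasDerivAt (fun y => stencilError h (fun s => f s y) x)
      (stencilError h (fun s => _root_.partialY f s y) x) y := by
  have hd := fun c => hf.hasDerivAt_right c y
  have hxx := hf.partialX.partialX.hasDerivAt_right x y
  rw [hf.partialX.partialY_partialX, hf.partialY_partialX] at hxx
  exact ((((((hd (x - 2 * h)).fun_neg.add ((hd (x - h)).const_mul 16)).sub
    ((hd x).const_mul 30)).add ((hd (x + h)).const_mul 16)).sub
    (hd (x + 2 * h))).div_const _).sub hxx

end Smooth2D

theorem iteratedDeriv_left (f : ℝ → ℝ → ℝ) (n : ℕ) (x y : ℝ) :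
    iteratedDeriv n (fun s => f s y) x = partialX^[n] f x y := by
  induction n generalizing x with
  | zero => rfl
  | succ n ih => rw [iteratedDeriv_succ, Function.iterate_succ_apply', funext ih]; rfl

theorem iteratedDeriv_right (f : ℝ → ℝ → ℝ) (n : ℕ) (x y : ℝ) :
    iteratedDeriv n (f x) y = partialY^[n] f x y := by
  induction n generalizing y with
  | zero => rfl
  | succ n ih => rw [iteratedDeriv_succ, Function.iterate_succ_apply', funext ih]; rfl

theorem partialDeriv2D_eq (a b : ℕ) (f : ℝ → ℝ → ℝ) (x y : ℝ) :
    partialDeriv2D a b f x y = partialX^[a] (partialY^[b] f) x y := by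
  simp_rw [partialDeriv2D, iteratedDeriv_right, iteratedDeriv_left]

theorem sum_integral_sq_stencilError_le {m : ℕ} (hm : m = 4 ∨ m = 5) {f : ℝ → ℝ → ℝ}
    (hf : Smooth2D f) {L h : ℝ} {M : ℕ} (hh : 0 < h) (hM : M * h = L)
    (hper : ∀ x y, f (x + L) y = f x y) :
    h ^ 4 * ∑ i ∈ Finset.range M, ∫ y in (0 : ℝ)..L, stencilError h (fun s => f s y) (i * h) ^ 2
      ≤ 1024 * h ^ (2 * m + 1) *
        ∫ y in (0 : ℝ)..L, ∫ x in (0 : ℝ)..L, partialX^[m + 1] f x y ^ 2 := by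
  have hL : 0 ≤ L := hM ▸ by positivity
  have hc : ∀ i : ℕ, Continuous fun y => stencilError h (fun s => f s y) (i * h) ^ 2 :=
    fun i => (hf.continuous_stencilError h _).pow 2
  have hD : Continuous (Function.uncurry fun y x => partialX^[m + 1] f x y ^ 2) :=
    (hf.iterate_partialX (m + 1)).swap.continuous.pow 2
  rw [← intervalIntegral.integral_finsetSum fun i _ => (hc i).intervalIntegrable _ _,
    ← intervalIntegral.integral_const_mul, ← intervalIntegral.integral_const_mul]
  refine intervalIntegral.integral_mono_on hL
    ((continuous_const.mul (continuous_finsetSum _ fun i _ => hc i)).intervalIntegrable _ _)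
    ((continuous_const.mul (intervalIntegral.continuous_parametric_intervalIntegral_of_continuous'
      hD _ _)).intervalIntegrable _ _) fun y _ => ?_
  have := sum_sq_stencilError_le hm (hf.contDiff_left y) hh hM fun x => hper x y
  simpa only [iteratedDeriv_left] using this

theorem sum_sum_sq_stencilError_le {f : ℝ → ℝ → ℝ} (hf : Smooth2D f) {L h : ℝ} {M : ℕ}
    (hh : 0 < h) (hM : M * h = L) (hper : ∀ x y, f (x + L) y = f x y) :
    h ^ 2 * ∑ i ∈ Finset.range M, ∑ j ∈ Finset.range M,
        stencilError h (fun s => f s (j * h)) (i * h) ^ 2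
      ≤ 2048 * h ^ 8 * ((∫ y in (0 : ℝ)..L, ∫ x in (0 : ℝ)..L, partialX^[6] f x y ^ 2)
        + ∫ y in (0 : ℝ)..L, ∫ x in (0 : ℝ)..L, partialX^[5] (partialY f) x y ^ 2) := by
  have hper' : ∀ x y, partialY f (x + L) y = partialY f x y := fun x y => by
    simp only [partialY, show f (x + L) = f x from funext (hper x)]
  have h1 := sum_integral_sq_stencilError_le (.inr rfl) hf hh hM hper
  have h2 := sum_integral_sq_stencilError_le (.inl rfl) hf.partialY hh hM hper'
  have h3 := Finset.sum_le_sum fun (i : ℕ) (_ : i ∈ Finset.range M) =>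
    sum_sq_samples_le (hf.hasDerivAt_stencilError h (i * h))
      (hf.partialY.continuous_stencilError h (i * h)) hh hM
  rw [← Finset.mul_sum, Finset.sum_add_distrib, ← Finset.mul_sum, ← Finset.mul_sum] at h3
  have h4 := mul_le_mul_of_nonneg_left h3 (show 0 ≤ h ^ 5 by positivity)
  have h1' := mul_le_mul_of_nonneg_left h1 (show 0 ≤ 2 * h by positivity)
  have h2' := mul_le_mul_of_nonneg_left h2 (show 0 ≤ 2 * h ^ 3 by positivity)
  simp only [Nat.reduceAdd, Nat.reduceMul] at h1' h2'
  refine le_of_mul_le_mul_left ?_ (show 0 < h ^ 4 by positivity)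
  linarith

theorem integral_sq_swap {f : ℝ → ℝ → ℝ} (hf : Smooth2D f) (L : ℝ) :
    ∫ y in (0 : ℝ)..L, ∫ x in (0 : ℝ)..L, f x y ^ 2
      = ∫ x in (0 : ℝ)..L, ∫ y in (0 : ℝ)..L, f x y ^ 2 := by
  refine intervalIntegral_intervalIntegral_swap (F := fun y x => f x y ^ 2) ?_
  have hc : Continuous (Function.uncurry fun y x => f x y ^ 2) := hf.swap.continuous.pow 2
  exact (hc.continuousOn.integrableOn_compact (isCompact_uIcc.prod isCompact_uIcc)).mono_set
    (Set.prod_mono Set.uIoc_subset_uIcc Set.uIoc_subset_uIcc)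

theorem top_order_le_H6normSq2D {L : ℝ} (hL : 0 ≤ L) (f : ℝ → ℝ → ℝ) :
    (∫ x in (0 : ℝ)..L, ∫ y in (0 : ℝ)..L, partialDeriv2D 6 0 f x y ^ 2)
      + (∫ x in (0 : ℝ)..L, ∫ y in (0 : ℝ)..L, partialDeriv2D 5 1 f x y ^ 2)
      + (∫ x in (0 : ℝ)..L, ∫ y in (0 : ℝ)..L, partialDeriv2D 0 6 f x y ^ 2)
      + (∫ x in (0 : ℝ)..L, ∫ y in (0 : ℝ)..L, partialDeriv2D 1 5 f x y ^ 2)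
      ≤ H6normSq2D L f := by
  set J : ℕ → ℕ → ℝ := fun a b =>
    ∫ x in (0 : ℝ)..L, ∫ y in (0 : ℝ)..L, partialDeriv2D a b f x y ^ 2
  have hJ0 : ∀ a b, 0 ≤ J a b := fun a b =>
    intervalIntegral.integral_nonneg hL fun _ _ =>
      intervalIntegral.integral_nonneg hL fun _ _ => sq_nonneg _
  change J 6 0 + J 5 1 + J 0 6 + J 1 5 ≤ ∑ a ∈ Finset.range 7, ∑ b ∈ Finset.range (7 - a), J a b
  rw [Finset.sum_sigma']
  refine le_trans (le_of_eq ?_) (Finset.sum_le_sum_of_subset_of_nonneg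
    (s := {⟨6, 0⟩, ⟨5, 1⟩, ⟨0, 6⟩, ⟨1, 5⟩}) (by decide) fun p _ _ => hJ0 p.1 p.2)
  simp [add_assoc]

/-- Discrete ℓ² truncation error estimate for the 2-D long stencil fourth order
discrete Laplacian, for smooth periodic test functions. -/
theorem long_stencil_laplacian_truncation_l2_2D (L : ℝ) (hL : 0 < L) :
    ∃ C : ℝ, 0 < C ∧
      ∀ N : ℕ, 0 < N →
        ∀ h : ℝ, h = L / (2 * N + 1) →
          ∀ f : ℝ → ℝ → ℝ, ContDiff ℝ (⊤ : ℕ∞) (fun p : ℝ × ℝ => f p.1 p.2) →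
            (∀ x y, f (x + L) y = f x y) → (∀ x y, f x (y + L) = f x y) →
            Real.sqrt (h ^ 2 *
                ∑ i ∈ Finset.range (2 * N + 1), ∑ j ∈ Finset.range (2 * N + 1),
                  (discLap4_2D h f ((i : ℝ) * h) ((j : ℝ) * h)
                    - contLap2D f ((i : ℝ) * h) ((j : ℝ) * h)) ^ 2)
              ≤ C * h ^ 4 * Real.sqrt (H6normSq2D L f) := by
  refine ⟨64, by norm_num, fun N _ h hh f hf hpx hpy => ?_⟩
  have hN : (0 : ℝ) < 2 * N + 1 := by positivity
  have hpos : 0 < h := hh ▸ div_pos hL hN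
  have hM : ((2 * N + 1 : ℕ) : ℝ) * h = L := by
    rw [hh]; push_cast; field_simp
  have hX := sum_sum_sq_stencilError_le hf hpos hM hpx
  have hY := sum_sum_sq_stencilError_le (f := Function.swap f) (Smooth2D.swap hf) hpos hM
    fun x y => hpy y x
  rw [Finset.sum_comm] at hY
  have hY6 : ∀ x y, partialX^[6] (Function.swap f) y x = partialDeriv2D 0 6 f x y := fun x y => by
    rw [partialDeriv2D_eq]; rfl
  have hY5 : ∀ x y, partialX^[5] (partialY (Function.swap f)) y x = partialDeriv2D 1 5 f x y :=
    fun x y => by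
      rw [partialDeriv2D_eq, Function.iterate_one, ← Smooth2D.iterate_partialY_partialX hf]; rfl
  rw [integral_sq_swap (Smooth2D.iterate_partialX hf 6),
    integral_sq_swap (Smooth2D.iterate_partialX (Smooth2D.partialY hf) 5)] at hX
  simp_rw [hY6, hY5] at hY
  have hX6 : ∀ x y, partialX^[6] f x y = partialDeriv2D 6 0 f x y := fun x y => by
    rw [partialDeriv2D_eq]; rfl
  have hX5 : ∀ x y, partialX^[5] (partialY f) x y = partialDeriv2D 5 1 f x y := fun x y => by
    rw [partialDeriv2D_eq]; rfl
  simp_rw [hX6, hX5] at hX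
  have hsplit : ∀ x y, (discLap4_2D h f x y - contLap2D f x y) ^ 2
      ≤ 2 * stencilError h (fun s => f s y) x ^ 2
        + 2 * stencilError h (fun s => Function.swap f s x) y ^ 2 := fun x y => by
    have : discLap4_2D h f x y - contLap2D f x y
        = stencilError h (fun s => f s y) x + stencilError h (fun s => Function.swap f s x) y := by
      simp only [discLap4_2D, contLap2D, stencilError, Function.swap]
      ring
    rw [this]
    exact add_sq_le.trans_eq (mul_add _ _ _)
  have hsum := mul_le_mul_of_nonneg_left
    (Finset.sum_le_sum fun (i : ℕ) (_ : i ∈ Finset.range (2 * N + 1)) =>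
      Finset.sum_le_sum fun (j : ℕ) (_ : j ∈ Finset.range (2 * N + 1)) => hsplit (i * h) (j * h))
    (sq_nonneg h)
  simp_rw [Finset.sum_add_distrib, ← Finset.mul_sum] at hsum
  have hH := mul_le_mul_of_nonneg_left (top_order_le_H6normSq2D hL.le f)
    (show 0 ≤ 4096 * h ^ 8 by positivity)
  calc _ ≤ Real.sqrt ((64 * h ^ 4) ^ 2 * H6normSq2D L f) := Real.sqrt_le_sqrt (by linarith)
    _ = 64 * h ^ 4 * Real.sqrt (H6normSq2D L f) := by
      rw [Real.sqrt_mul (by positivity), Real.sqrt_sq (by positivity)]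
end

section
/- There exists a constant C₁ > 0 such that for every L > 0, every positive integer N, with h = L/(2N+1), and every integer k with 0 ≤ k ≤ N, setting λ_k = −4 sin²(kπh/L)/h² and λ_{k,(4)} = λ_k − (h²/12) λ_k², one has |λ_{k,(4)} + 4k²π²/L²| ≤ C₁ · h⁴ · (2kπ/L)⁶. -/
open Real

/-- The function `sin² + sin⁴ / 3` agrees with the square function up to sixth order. -/
lemma abs_sq_sub_sin_sq_sub_le {x : ℝ} (hx : 0 ≤ x) :
    |x ^ 2 - Real.sin x ^ 2 - Real.sin x ^ 4 / 3| ≤ x ^ 6 := by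
  have h_sq : Real.sin x ^ 2 ≤ x ^ 2 :=
    Real.sin_sq_le_sq
  have h_four : Real.sin x ^ 4 ≤ x ^ 4 := by
    calc Real.sin x ^ 4 = (Real.sin x ^ 2) ^ 2 := by ring
      _ ≤ (x ^ 2) ^ 2 := by gcongr
      _ = x ^ 4 := by ring
  have h_nonneg : 0 ≤ Real.sin x ^ 4 := by positivity
  have h_six : 0 ≤ x ^ 6 := by positivity
  rw [abs_le]
  rcases le_total x 1 with h_le | h_ge
  · have h_bound := Real.sin_bound (x := x) (by rwa [abs_of_nonneg hx])
    have h_lower : x - x ^ 3 / 6 ≤ Real.sin x := Real.sin_ge_sub_cube hx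
    have h_upper : Real.sin x ≤ x - x ^ 3 / 6 + x ^ 5 / 100 := by
      rw [abs_of_nonneg hx] at h_bound
      linarith [(abs_le.mp h_bound).2]
    have h_sq_le : x ^ 2 ≤ 1 := pow_le_one₀ hx h_le
    have h_cubic : 0 ≤ x - x ^ 3 / 6 := by nlinarith
    have h_sq_lower : x ^ 2 - x ^ 4 / 3 + x ^ 6 / 36 ≤ Real.sin x ^ 2 := by
      calc x ^ 2 - x ^ 4 / 3 + x ^ 6 / 36 = (x - x ^ 3 / 6) ^ 2 := by ring
        _ ≤ Real.sin x ^ 2 := by gcongr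
    have h_four_lower : x ^ 4 - 2 / 3 * x ^ 6 ≤ Real.sin x ^ 4 := by
      have h_base : 0 ≤ x ^ 2 - x ^ 4 / 3 := by nlinarith [sq_nonneg x]
      calc x ^ 4 - 2 / 3 * x ^ 6 ≤ (x ^ 2 - x ^ 4 / 3) ^ 2 := by
            nlinarith [sq_nonneg (x ^ 4)]
        _ ≤ (Real.sin x ^ 2) ^ 2 := by
            gcongr
            linarith
        _ = Real.sin x ^ 4 := by ring
    have h_sq_upper : Real.sin x ^ 2 ≤ x ^ 2 - x ^ 4 / 3 + x ^ 6 / 36 + x ^ 6 / 50 := by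
      have h_mul : (Real.sin x - (x - x ^ 3 / 6)) * (Real.sin x + (x - x ^ 3 / 6)) ≤
          x ^ 5 / 100 * (2 * x) := by
        have h_cube : 0 ≤ x ^ 3 := by positivity
        have h_sin := Real.sin_le hx
        apply mul_le_mul <;> linarith [pow_nonneg hx 5]
      linarith
    constructor <;> linarith
  · have h_pow_two : x ^ 2 ≤ x ^ 6 := pow_le_pow_right₀ h_ge (by norm_num)
    have h_pow_four : x ^ 4 ≤ x ^ 6 := pow_le_pow_right₀ h_ge (by norm_num)
    constructor <;> linarith [sq_nonneg (Real.sin x)]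

/-- Eigenvalue comparison between the long stencil fourth order second difference
operator and the continuous second derivative: for `0 ≤ k ≤ N`, with
`h = L/(2N+1)`, `λ_k = −4 sin²(kπh/L)/h²` and `λ_{k,(4)} = λ_k − (h²/12) λ_k²`,
one has `|λ_{k,(4)} + 4k²π²/L²| ≤ C₁ h⁴ (2kπ/L)⁶`. -/
theorem eigenvalue_fourth_order_estimate :
    ∃ C₁ : ℝ, 0 < C₁ ∧
      ∀ (L : ℝ) (N : ℕ), 0 < L → 0 < N →
        ∀ h : ℝ, h = L / (2 * N + 1) →
          ∀ k : ℕ, k ≤ N →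
            ∀ lamk lamk4 : ℝ,
              lamk = -4 * Real.sin ((k : ℝ) * π * h / L) ^ 2 / h ^ 2 →
              lamk4 = lamk - h ^ 2 / 12 * lamk ^ 2 →
              |lamk4 + 4 * (k : ℝ) ^ 2 * π ^ 2 / L ^ 2|
                ≤ C₁ * h ^ 4 * (2 * (k : ℝ) * π / L) ^ 6 := by
  refine ⟨1, one_pos, ?_⟩
  rintro L N hL - h hh k - lamk lamk4 rfl rfl
  have h_pos : 0 < h := by
    rw [hh]
    positivity
  set x : ℝ := (k : ℝ) * π * h / L with hx
  have hx_nonneg : 0 ≤ x := by positivity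
  have h_diff : -4 * Real.sin x ^ 2 / h ^ 2 - h ^ 2 / 12 * (-4 * Real.sin x ^ 2 / h ^ 2) ^ 2 +
      4 * (k : ℝ) ^ 2 * π ^ 2 / L ^ 2 =
      4 / h ^ 2 * (x ^ 2 - Real.sin x ^ 2 - Real.sin x ^ 4 / 3) := by
    have h_freq : 4 * (k : ℝ) ^ 2 * π ^ 2 / L ^ 2 = 4 / h ^ 2 * x ^ 2 := by
      rw [hx]
      field_simp
    rw [h_freq]
    field_simp
    ring
  have h_rhs : 1 * h ^ 4 * (2 * (k : ℝ) * π / L) ^ 6 = 64 / h ^ 2 * x ^ 6 := by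
    rw [hx]
    field_simp
    ring
  rw [h_diff, h_rhs, abs_mul, abs_of_pos (by positivity)]
  gcongr
  · norm_num
  · exact abs_sq_sub_sin_sq_sub_le hx_nonneg
end

section
/- For every real number t ≥ 0 one has sin²(t) + (1/3)·sin⁴(t) ≤ t². -/
/-- For `t ≥ 0` one has `sin t cos t (1 + (2/3) sin² t) ≤ t`. -/
theorem sin_mul_cos_mul_one_add_sin_sq_le (t : ℝ) (ht : 0 ≤ t) :
    Real.sin t * Real.cos t * (1 + 2 / 3 * Real.sin t ^ 2) ≤ t := by
  have hderiv (x : ℝ) : HasDerivAt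
      (fun y ↦ y - Real.sin y * Real.cos y * (1 + 2 / 3 * Real.sin y ^ 2))
      (8 / 3 * Real.sin x ^ 4) x := by
    have hs := Real.hasDerivAt_sin x
    refine ((hasDerivAt_id x).sub ((hs.mul (Real.hasDerivAt_cos x)).mul
      (((hs.pow 2).const_mul (2 / 3)).const_add 1))).congr_deriv ?_
    simp only [Pi.mul_apply, Pi.pow_apply]
    push_cast
    linear_combination (-1 - 2 * Real.sin x ^ 2) * Real.sin_sq_add_cos_sq x
  have hmono := monotone_of_hasDerivAt_nonneg hderiv fun x ↦ by
    show 0 ≤ 8 / 3 * Real.sin x ^ 4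
    positivity
  simpa using hmono ht

/-- For every real `t ≥ 0`, `sin²(t) + (1/3) sin⁴(t) ≤ t²`. -/
theorem sin_sq_add_third_sin_pow_four_le (t : ℝ) (ht : 0 ≤ t) :
    Real.sin t ^ 2 + (1 / 3) * Real.sin t ^ 4 ≤ t ^ 2 := by
  have hderiv (x : ℝ) : HasDerivAt
      (fun y ↦ y ^ 2 - (Real.sin y ^ 2 + (1 / 3) * Real.sin y ^ 4))
      (2 * (x - Real.sin x * Real.cos x * (1 + 2 / 3 * Real.sin x ^ 2))) x := by
    have hs := Real.hasDerivAt_sin x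
    refine ((hasDerivAt_pow 2 x).sub
      ((hs.pow 2).add ((hs.pow 4).const_mul (1 / 3)))).congr_deriv ?_
    push_cast
    ring
  have hmono := monotoneOn_of_hasDerivWithinAt_nonneg (convex_Ici (0 : ℝ))
    (fun x _ ↦ (hderiv x).continuousAt.continuousWithinAt)
    (fun x _ ↦ (hderiv x).hasDerivWithinAt) fun x hx ↦ by
      have := sin_mul_cos_mul_one_add_sin_sq_le x (interior_subset hx)
      linarith
  simpa using hmono Set.self_mem_Ici ht ht
end

section
/- Let L > 0, let m be a positive integer, set h = L/m, let k ∈ ℤ, and define the periodic grid function g : ℤ/mℤ → ℂ by g_i = exp(2πi·k·(i·h)/L) (which is well defined modulo m). Then for every i, (−g_{i−2} + 16 g_{i−1} − 30 g_i + 16 g_{i+1} − g_{i+2})/(12h²) = (λ_k − (h²/12)·λ_k²) · g_i, where λ_k = −4 sin²(kπh/L)/h². -/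
open Complex

/-- The powers of an `m`-th root of unity, indexed by `ZMod m`, are shifted by multiplication. -/
theorem pow_val_add_one_of_pow_eq_one {M : Type*} [Monoid M] {m : ℕ} [NeZero m] {w : M}
    (hw : w ^ m = 1) (i : ZMod m) : w ^ (i + 1).val = w ^ i.val * w := by
  rw [ZMod.val_add, ZMod.val_one_eq_one_mod, Nat.add_mod_mod, ← pow_eq_pow_mod _ hw, pow_succ]

theorem neg_four_sin_sq_mul_exp (z : ℂ) :
    -4 * Complex.sin z ^ 2 * Complex.exp (2 * z * I) = (Complex.exp (2 * z * I) - 1) ^ 2 := by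
  have hsq : Complex.exp (2 * z * I) = Complex.exp (z * I) ^ 2 := by
    rw [← Complex.exp_nat_mul]
    congr 1
    push_cast
    ring
  have hinv : Complex.exp (-z * I) * Complex.exp (z * I) = 1 := by
    rw [← Complex.exp_add]
    simp
  rw [hsq, Complex.sin]
  set u := Complex.exp (z * I)
  set v := Complex.exp (-z * I)
  linear_combination (-(v - u) ^ 2 * u ^ 2) * I_sq + (v * u + 1 - 2 * u ^ 2) * hinv

/-- The complex exponential grid function of wavenumber `k` is an eigenfunction of
the long stencil fourth order second difference operator on a uniform periodic
grid of `m` points, with eigenvalue `λ_k − (h²/12) λ_k²`,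
where `λ_k = −4 sin²(kπh/L)/h²`. -/
theorem fourth_order_stencil_eigenfunction (L : ℝ) (hL : 0 < L) (m : ℕ) [NeZero m]
    (h : ℝ) (hh : h = L / m) (k : ℤ) (g : ZMod m → ℂ)
    (hg : ∀ i : ZMod m,
      g i = Complex.exp (2 * (Real.pi : ℂ) * Complex.I * (k : ℂ)
        * (((i.val : ℝ) * h : ℝ) : ℂ) / (L : ℂ)))
    (lamk : ℝ) (hlam : lamk = -4 * Real.sin ((k : ℝ) * Real.pi * h / L) ^ 2 / h ^ 2) :
    ∀ i : ZMod m,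
      (-g (i - 2) + 16 * g (i - 1) - 30 * g i + 16 * g (i + 1) - g (i + 2))
          / (12 * (h : ℂ) ^ 2)
        = ((lamk - h ^ 2 / 12 * lamk ^ 2 : ℝ) : ℂ) * g i := by
  have hm : (m : ℂ) ≠ 0 := Nat.cast_ne_zero.mpr (NeZero.ne m)
  have hLc : (L : ℂ) ≠ 0 := Complex.ofReal_ne_zero.mpr hL.ne'
  have hhc : (h : ℂ) = L / m := by rw [hh]; push_cast; rfl
  have hh0 : (h : ℂ) ≠ 0 := by rw [hhc]; exact div_ne_zero hLc hm
  set z : ℂ := k * Real.pi * h / L with hz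
  have hS := neg_four_sin_sq_mul_exp z
  set w := Complex.exp (2 * z * I) with hw
  have hwm : w ^ m = 1 := by
    rw [hw, ← Complex.exp_nat_mul, Complex.exp_eq_one_iff]
    refine ⟨k, ?_⟩
    rw [hz, hhc]
    field_simp
  have hgw (i : ZMod m) : g i = w ^ i.val := by
    rw [hg, hw, ← Complex.exp_nat_mul, hz]
    congr 1
    push_cast
    ring
  have hshift (i : ZMod m) : g (i + 1) = g i * w := by
    rw [hgw, hgw, pow_val_add_one_of_pow_eq_one hwm]
  have hlamc : (lamk : ℂ) = -4 * Complex.sin z ^ 2 / (h : ℂ) ^ 2 := by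
    rw [hlam, hz]
    push_cast
    rfl
  intro i
  have h₁ : g (i - 1) = g (i - 2) * w := by rw [← hshift]; congr 1; ring
  have h₂ : g i = g (i - 1) * w := by rw [← hshift]; congr 1; ring
  have h₃ : g (i + 2) = g (i + 1) * w := by rw [← hshift]; congr 1; ring
  rw [h₃, hshift, h₂, h₁]
  push_cast
  rw [hlamc]
  set S := -4 * Complex.sin z ^ 2
  set a := g (i - 2)
  have key : a * (-1 + 16 * w - 30 * w ^ 2 + 16 * w ^ 3 - w ^ 4)
      = (12 * S - S ^ 2) * (a * w ^ 2) := by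
    linear_combination (-12 * a * w + a * (S * w + (w - 1) ^ 2)) * hS
  field_simp
  linear_combination key
end

section
/- For every periodic grid function f on the m×m grid with spacing h = L/m one has ‖Δ_h f‖₂ ≤ ‖Δ_{h,(4)} f‖₂. -/
open Finset

/-- The standard five-point discrete Laplacian on the periodic grid. -/
noncomputable def lapStd (m : ℕ) (h : ℝ) (φ : ZMod m → ZMod m → ℝ) :
    ZMod m → ZMod m → ℝ :=
  fun i j => (φ (i + 1) j + φ (i - 1) j + φ i (j + 1) + φ i (j - 1) - 4 * φ i j) / h ^ 2

/-- The long-stencil fourth-order discrete Laplacian `Δ_{h,(4)} = D²_{x,(4)} + D²_{y,(4)}`. -/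
noncomputable def lap4 (m : ℕ) (h : ℝ) (φ : ZMod m → ZMod m → ℝ) :
    ZMod m → ZMod m → ℝ :=
  fun i j =>
    (-φ (i - 2) j + 16 * φ (i - 1) j - 30 * φ i j + 16 * φ (i + 1) j - φ (i + 2) j)
        / (12 * h ^ 2)
      + (-φ i (j - 2) + 16 * φ i (j - 1) - 30 * φ i j + 16 * φ i (j + 1) - φ i (j + 2))
        / (12 * h ^ 2)

section SecondDifference

variable {G : Type*} [AddCommGroup G]

/-- The negative second difference of `g` in the direction `s`. -/
def negSecondDiff (s : G) (g : G → ℝ) : G → ℝ :=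
  fun x => 2 * g x - g (x + s) - g (x - s)

lemma negSecondDiff_comm (s t : G) (g : G → ℝ) :
    negSecondDiff s (negSecondDiff t g) = negSecondDiff t (negSecondDiff s g) := by
  funext x
  simp only [negSecondDiff, add_right_comm x t s, sub_right_comm x t s, sub_add_eq_add_sub]
  ring

variable [Fintype G]

lemma sum_mul_negSecondDiff (s : G) (f g : G → ℝ) :
    ∑ x, f x * negSecondDiff s g x = ∑ x, negSecondDiff s f x * g x := by
  have h₁ : ∑ x, f (x + s) * g x = ∑ x, f x * g (x - s) := by
    simpa using Equiv.sum_comp (Equiv.addRight s) fun x => f x * g (x - s)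
  have h₂ : ∑ x, f x * g (x + s) = ∑ x, f (x - s) * g x := by
    simpa using Equiv.sum_comp (Equiv.addRight s) fun x => f (x - s) * g x
  simp only [negSecondDiff, mul_sub, sub_mul, Finset.sum_sub_distrib, h₁, h₂, mul_left_comm,
    mul_assoc]
  ring

lemma sum_mul_negSecondDiff_self_nonneg (s : G) (g : G → ℝ) :
    0 ≤ ∑ x, g x * negSecondDiff s g x := by
  have h₁ : ∑ x, g (x + s) ^ 2 = ∑ x, g x ^ 2 :=
    Equiv.sum_comp (Equiv.addRight s) fun x => g x ^ 2
  have h₂ : ∑ x, g x * g (x + s) = ∑ x, g x * g (x - s) := by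
    rw [← Equiv.sum_comp (Equiv.addRight s) fun x => g x * g (x - s)]
    simp [mul_comm]
  have h₃ : ∑ x, g x * negSecondDiff s g x = ∑ x, (g (x + s) - g x) ^ 2 := by
    have hl : ∑ x, g x * negSecondDiff s g x
        = 2 * ∑ x, g x ^ 2 - ∑ x, g x * g (x + s) - ∑ x, g x * g (x - s) := by
      rw [Finset.mul_sum, ← Finset.sum_sub_distrib, ← Finset.sum_sub_distrib]
      exact Finset.sum_congr rfl fun x _ => by simp only [negSecondDiff]; ring
    have hr : ∑ x, (g (x + s) - g x) ^ 2
        = ∑ x, g (x + s) ^ 2 + ∑ x, g x ^ 2 - 2 * ∑ x, g x * g (x + s) := by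
      rw [Finset.mul_sum, ← Finset.sum_add_distrib, ← Finset.sum_sub_distrib]
      exact Finset.sum_congr rfl fun x _ => by ring
    rw [hl, hr, h₁, h₂]
    ring
  rw [h₃]
  positivity

lemma sum_negSecondDiff_mul_iterate_nonneg (s t : G) (f : G → ℝ) :
    0 ≤ ∑ x, negSecondDiff t f x * negSecondDiff s (negSecondDiff s f) x := by
  rw [sum_mul_negSecondDiff, negSecondDiff_comm]
  simpa only [mul_comm] using sum_mul_negSecondDiff_self_nonneg t (negSecondDiff s f)

lemma sum_sq_negSecondDiff_le (s t : G) (f : G → ℝ) :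
    ∑ x, (negSecondDiff s f x + negSecondDiff t f x) ^ 2
      ≤ ∑ x, (negSecondDiff s f x + negSecondDiff t f x
          + (negSecondDiff s (negSecondDiff s f) x
            + negSecondDiff t (negSecondDiff t f) x) / 12) ^ 2 := by
  have hss := sum_negSecondDiff_mul_iterate_nonneg s s f
  have hst := sum_negSecondDiff_mul_iterate_nonneg s t f
  have hts := sum_negSecondDiff_mul_iterate_nonneg t s f
  have htt := sum_negSecondDiff_mul_iterate_nonneg t t f
  have hsum := add_nonneg (add_nonneg hss hst) (add_nonneg hts htt)
  simp only [← Finset.sum_add_distrib] at hsum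
  rw [← sub_nonneg, ← Finset.sum_sub_distrib]
  refine (mul_nonneg (by norm_num : (0 : ℝ) ≤ 1 / 6) hsum).trans ?_
  rw [Finset.mul_sum]
  refine Finset.sum_le_sum fun x _ => ?_
  nlinarith [sq_nonneg (negSecondDiff s (negSecondDiff s f) x
    + negSecondDiff t (negSecondDiff t f) x)]

end SecondDifference

lemma lapStd_eq_negSecondDiff (m : ℕ) (h : ℝ) (f : ZMod m → ZMod m → ℝ) (x : ZMod m × ZMod m) :
    lapStd m h f x.1 x.2 = -(negSecondDiff (1, 0) (fun y => f y.1 y.2) x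
      + negSecondDiff (0, 1) (fun y => f y.1 y.2) x) / h ^ 2 := by
  simp only [lapStd, negSecondDiff, Prod.fst_add, Prod.snd_add, Prod.fst_sub, Prod.snd_sub,
    add_zero, sub_zero]
  ring

lemma lap4_eq_negSecondDiff (m : ℕ) (h : ℝ) (f : ZMod m → ZMod m → ℝ) (x : ZMod m × ZMod m) :
    lap4 m h f x.1 x.2 = -(negSecondDiff (1, 0) (fun y => f y.1 y.2) x
      + negSecondDiff (0, 1) (fun y => f y.1 y.2) x
      + (negSecondDiff (1, 0) (negSecondDiff (1, 0) (fun y => f y.1 y.2)) x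
        + negSecondDiff (0, 1) (negSecondDiff (0, 1) (fun y => f y.1 y.2)) x) / 12) / h ^ 2 := by
  simp only [lap4, negSecondDiff, Prod.fst_add, Prod.snd_add, Prod.fst_sub, Prod.snd_sub,
    add_zero, sub_zero, add_assoc, sub_sub, one_add_one_eq_two, sub_add_cancel, add_sub_cancel_right]
  ring

/-- `‖Δ_h f‖₂ ≤ ‖Δ_{h,(4)} f‖₂` for every periodic grid function `f`. -/
theorem lapStd_norm_le_lap4_norm (L : ℝ) (hL : 0 < L) (m : ℕ) [NeZero m]
    (h : ℝ) (hh : h = L / m) (f : ZMod m → ZMod m → ℝ) :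
    Real.sqrt (h ^ 2 * ∑ i : ZMod m, ∑ j : ZMod m, (lapStd m h f i j) ^ 2)
      ≤ Real.sqrt (h ^ 2 * ∑ i : ZMod m, ∑ j : ZMod m, (lap4 m h f i j) ^ 2) := by
  apply Real.sqrt_le_sqrt
  refine mul_le_mul_of_nonneg_left ?_ (sq_nonneg h)
  rw [← Fintype.sum_prod_type' fun i j => lapStd m h f i j ^ 2,
    ← Fintype.sum_prod_type' fun i j => lap4 m h f i j ^ 2]
  simp only [lapStd_eq_negSecondDiff, lap4_eq_negSecondDiff, div_pow _ (h ^ 2), neg_sq,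
    ← Finset.sum_div]
  gcongr ?_ / _
  exact sum_sq_negSecondDiff_le _ _ _
end

section
/- Let L > 0. There exists a constant C > 0, depending only on L, such that for every positive integer m, with h = L/m, and every periodic grid function f on the m×m grid, ‖f‖₆ ≤ C ( ‖f‖₂ + ‖∇_h f‖₂ ). -/
open Finset

/-- On a cycle, two values of a function differ by at most its total variation. -/
theorem ZMod.le_add_sum_abs_sub {m : ℕ} [NeZero m] (g : ZMod m → ℝ) (i k : ZMod m) :
    g k ≤ g i + ∑ l, |g (l + 1) - g l| := by
  have telescope : ∀ n : ℕ,
      g (i + n) ≤ g i + ∑ l ∈ range n, |g (i + l + 1) - g (i + l)| := by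
    intro n
    induction n with
    | zero => simp
    | succ n ih =>
      rw [sum_range_succ]
      have := le_abs_self (g (i + n + 1) - g (i + n))
      push_cast
      rw [← add_assoc]
      linarith
  have hk : i + ((k - i).val : ZMod m) = k := by
    rw [ZMod.natCast_zmod_val]
    ring
  have h := telescope (k - i).val
  rw [hk] at h
  refine h.trans (add_le_add_right ?_ _)
  have hinj : Set.InjOn (fun l : ℕ => i + (l : ZMod m)) (range (k - i).val) := by
    intro a ha b hb hab
    have hlt := ZMod.val_lt (k - i)
    have ha' : a < m := (mem_range.1 ha).trans hlt
    have hb' : b < m := (mem_range.1 hb).trans hlt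
    have := congrArg ZMod.val (add_left_cancel hab)
    rwa [ZMod.val_natCast_of_lt ha', ZMod.val_natCast_of_lt hb'] at this
  rw [← sum_image (f := fun x => |g (x + 1) - g x|) hinj]
  exact sum_le_sum_of_subset_of_nonneg (subset_univ _) fun _ _ _ => abs_nonneg _

/-- On a cycle, a function is bounded by its mean plus its total variation. -/
theorem ZMod.le_mean_add_sum_abs_sub {m : ℕ} [NeZero m] (g : ZMod m → ℝ) (k : ZMod m) :
    g k ≤ (∑ i, g i) / m + ∑ l, |g (l + 1) - g l| := by
  have hm : (0 : ℝ) < m := by exact_mod_cast NeZero.pos m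
  have h := sum_le_sum fun i (_ : i ∈ univ) => ZMod.le_add_sum_abs_sub g i k
  rw [sum_add_distrib] at h
  simp only [sum_const, card_univ, ZMod.card, nsmul_eq_mul] at h
  rw [div_add' _ _ _ hm.ne', le_div_iff₀ hm]
  linarith

/-- A discrete Gagliardo–Nirenberg inequality: the square sum over a periodic grid is controlled
by the mean and the total variations in the two directions. -/
theorem ZMod.sum_sq_le_mul_variation {m : ℕ} [NeZero m] (g : ZMod m → ZMod m → ℝ)
    (hg : ∀ i j, 0 ≤ g i j) :
    ∑ i, ∑ j, g i j ^ 2 ≤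
      ((∑ i, ∑ j, g i j) / m + ∑ i, ∑ j, |g (i + 1) j - g i j|) *
        ((∑ i, ∑ j, g i j) / m + ∑ i, ∑ j, |g i (j + 1) - g i j|) := by
  have hcol : ∀ i j, g i j ≤ (∑ l, g l j) / m + ∑ l, |g (l + 1) j - g l j| := fun i j =>
    ZMod.le_mean_add_sum_abs_sub (fun l => g l j) i
  have hrow : ∀ i j, g i j ≤ (∑ l, g i l) / m + ∑ l, |g i (l + 1) - g i l| := fun i j =>
    ZMod.le_mean_add_sum_abs_sub (g i) j
  calc ∑ i, ∑ j, g i j ^ 2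
      ≤ ∑ i, ∑ j, ((∑ l, g i l) / m + ∑ l, |g i (l + 1) - g i l|) *
          ((∑ l, g l j) / m + ∑ l, |g (l + 1) j - g l j|) := by
        refine sum_le_sum fun i _ => sum_le_sum fun j _ => ?_
        rw [sq]
        exact mul_le_mul (hrow i j) (hcol i j) (hg i j) ((hg i j).trans (hrow i j))
    _ = _ := by
        rw [← sum_mul_sum, mul_comm, sum_add_distrib, sum_add_distrib, ← sum_div, ← sum_div,
          sum_comm (f := fun j l => g l j), sum_comm (f := fun j l => |g (l + 1) j - g l j|)]

theorem abs_abs_cube_sub_abs_cube_le (a b : ℝ) :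
    |(|a| ^ 3 - |b| ^ 3)| ≤ 3 / 2 * (|a - b| * a ^ 2 + |a - b| * b ^ 2) := by
  have hfac : |a| ^ 3 - |b| ^ 3 = (|a| - |b|) * (|a| ^ 2 + |a| * |b| + |b| ^ 2) := by ring
  have hpos : 0 ≤ |a| ^ 2 + |a| * |b| + |b| ^ 2 := by positivity
  rw [hfac, abs_mul, abs_of_nonneg hpos]
  calc |(|a| - |b|)| * (|a| ^ 2 + |a| * |b| + |b| ^ 2)
      ≤ |a - b| * (3 / 2 * (|a| ^ 2 + |b| ^ 2)) := by
        refine mul_le_mul (abs_abs_sub_abs_le a b) ?_ hpos (abs_nonneg _)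
        nlinarith [sq_nonneg (|a| - |b|)]
    _ = _ := by rw [sq_abs, sq_abs]; ring

/-- The variation of `|f|³` along a permutation, estimated by Cauchy–Schwarz. -/
theorem sum_abs_cube_variation_le {ι : Type*} [Fintype ι] (e : ι ≃ ι) (f : ι → ℝ) :
    ∑ x, |(|f (e x)| ^ 3 - |f x| ^ 3)| ≤
      3 * (√(∑ x, (f (e x) - f x) ^ 2) * √(∑ x, f x ^ 4)) := by
  have hcs : ∀ u : ι → ℝ, ∑ x, |f (e x) - f x| * u x ^ 2 ≤
      √(∑ x, (f (e x) - f x) ^ 2) * √(∑ x, u x ^ 4) := by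
    intro u
    have h := Real.sum_mul_le_sqrt_mul_sqrt univ (fun x => |f (e x) - f x|) fun x => u x ^ 2
    simpa only [sq_abs, ← pow_mul] using h
  have h1 := hcs fun x => f (e x)
  have h2 := hcs f
  rw [Equiv.sum_comp e fun x => f x ^ 4] at h1
  have h3 := sum_le_sum fun x (_ : x ∈ univ) => abs_abs_cube_sub_abs_cube_le (f (e x)) (f x)
  rw [← mul_sum, sum_add_distrib] at h3
  linarith

/-- Eliminating the fourth moment between an interpolation bound and a Hölder bound. -/
theorem sq_mul_le_pow_six {X N h S₂ S₄ S₆ : ℝ} (hN : 0 ≤ N) (hNX : N ≤ X) (hS₂ : 0 ≤ S₂)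
    (hS₆ : 0 ≤ S₆) (hNsq : N ^ 2 = h ^ 2 * S₂) (hS₆S₄ : S₆ ≤ X ^ 2 * S₄)
    (hS₄sq : S₄ ^ 2 ≤ S₂ * S₆) : h ^ 2 * S₆ ≤ X ^ 6 := by
  have hS₆S₂ : S₆ ≤ X ^ 4 * S₂ := by
    rcases hS₆.eq_or_lt with h0 | hpos
    · rw [← h0]
      positivity
    · refine le_of_mul_le_mul_right ?_ hpos
      calc S₆ * S₆ ≤ (X ^ 2 * S₄) * (X ^ 2 * S₄) :=
            mul_le_mul hS₆S₄ hS₆S₄ hS₆ (hS₆.trans hS₆S₄)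
        _ = X ^ 4 * S₄ ^ 2 := by ring
        _ ≤ X ^ 4 * (S₂ * S₆) := by gcongr
        _ = _ := by ring
  calc h ^ 2 * S₆ ≤ h ^ 2 * (X ^ 4 * S₂) := by gcongr
    _ = X ^ 4 * N ^ 2 := by rw [hNsq]; ring
    _ ≤ X ^ 4 * X ^ 2 := by gcongr
    _ = _ := by ring

set_option maxHeartbeats 1000000 in
/-- Discrete Sobolev embedding `H_h^1 ↪ ℓ^6` on the periodic grid:
`‖f‖₆ ≤ C (‖f‖₂ + ‖∇_h f‖₂)` with `C` depending only on `L`. -/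
theorem discrete_sobolev_embedding_l6 (L : ℝ) (hL : 0 < L) :
    ∃ C : ℝ, 0 < C ∧
      ∀ (m : ℕ) [NeZero m], ∀ f : ZMod m → ZMod m → ℝ,
        ((L / m) ^ 2 * ∑ i : ZMod m, ∑ j : ZMod m, |f i j| ^ 6) ^ ((1 : ℝ) / 6)
          ≤ C * (Real.sqrt ((L / m) ^ 2 * ∑ i : ZMod m, ∑ j : ZMod m, (f i j) ^ 2)
              + Real.sqrt (∑ i : ZMod m, ∑ j : ZMod m,
                  ((f (i + 1) j - f i j) ^ 2 + (f i (j + 1) - f i j) ^ 2))) := by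
  refine ⟨1 / L + 3, by positivity, fun m _ f => ?_⟩
  have hm : (0 : ℝ) < m := by exact_mod_cast NeZero.pos m
  set F : ZMod m × ZMod m → ℝ := fun x => f x.1 x.2
  set S₂ := ∑ i, ∑ j, f i j ^ 2
  set S₆ := ∑ i, ∑ j, |f i j| ^ 6
  set D := ∑ i, ∑ j, ((f (i + 1) j - f i j) ^ 2 + (f i (j + 1) - f i j) ^ 2)
  set S₄ := ∑ x, F x ^ 4
  set N := √((L / m) ^ 2 * S₂) with hN
  set G := √D
  have hS₂F : S₂ = ∑ x, F x ^ 2 := by rw [Fintype.sum_prod_type]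
  have hS₆F : S₆ = ∑ x, |F x| ^ 6 := by rw [Fintype.sum_prod_type]
  have hS₂0 : 0 ≤ S₂ := by positivity
  have hS₄0 : 0 ≤ S₄ := by positivity
  have hS₆0 : 0 ≤ S₆ := by positivity
  have hN0 : 0 ≤ N := Real.sqrt_nonneg _
  have hG0 : 0 ≤ G := Real.sqrt_nonneg _
  have hNsq : N ^ 2 = (L / m) ^ 2 * S₂ := Real.sq_sqrt (by positivity)
  have hcube : (∑ i, ∑ j, |f i j| ^ 3) / m ≤ 1 / L * N * √S₄ := by
    have h := Real.sum_mul_le_sqrt_mul_sqrt univ (fun x => |F x|) fun x => F x ^ 2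
    have hprod : ∀ x, |F x| * F x ^ 2 = |F x| ^ 3 := fun x => by rw [← sq_abs (F x)]; ring
    simp only [sq_abs, ← pow_mul, hprod] at h
    rw [← hS₂F, Fintype.sum_prod_type] at h
    rw [hN, Real.sqrt_mul (sq_nonneg _), Real.sqrt_sq (by positivity), div_le_iff₀ hm]
    refine h.trans_eq ?_
    field_simp
    rfl
  have hvar₁ : ∑ i, ∑ j, |(|f (i + 1) j| ^ 3 - |f i j| ^ 3)| ≤ 3 * (G * √S₄) := by
    have h := sum_abs_cube_variation_le ((Equiv.addRight (1 : ZMod m)).prodCongr (.refl _)) F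
    rw [Fintype.sum_prod_type] at h
    refine h.trans ?_
    gcongr
    rw [Fintype.sum_prod_type]
    exact Real.sqrt_le_sqrt <| sum_le_sum fun i _ => sum_le_sum fun j _ =>
      show (f (i + 1) j - f i j) ^ 2 ≤ _ from le_add_of_nonneg_right (sq_nonneg _)
  have hvar₂ : ∑ i, ∑ j, |(|f i (j + 1)| ^ 3 - |f i j| ^ 3)| ≤ 3 * (G * √S₄) := by
    have h := sum_abs_cube_variation_le ((Equiv.refl _).prodCongr (.addRight (1 : ZMod m))) F
    rw [Fintype.sum_prod_type] at h
    refine h.trans ?_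
    gcongr
    rw [Fintype.sum_prod_type]
    exact Real.sqrt_le_sqrt <| sum_le_sum fun i _ => sum_le_sum fun j _ =>
      show (f i (j + 1) - f i j) ^ 2 ≤ _ from le_add_of_nonneg_left (sq_nonneg _)
  set K := 1 / L + 3 with hK
  have hL' : 0 < 1 / L := by positivity
  have hfactor : 1 / L * N * √S₄ + 3 * (G * √S₄) ≤ K * (N + G) * √S₄ := by
    have : 1 / L * N + 3 * G ≤ K * (N + G) := by
      rw [hK]
      nlinarith [mul_nonneg hL'.le hG0]
    nlinarith [mul_le_mul_of_nonneg_right this (Real.sqrt_nonneg S₄)]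
  have hS₆S₄ : S₆ ≤ (K * (N + G)) ^ 2 * S₄ := by
    have h := ZMod.sum_sq_le_mul_variation (fun i j => |f i j| ^ 3) fun i j => by positivity
    simp only [← pow_mul] at h
    calc S₆ ≤ _ := h
      _ ≤ (K * (N + G) * √S₄) * (K * (N + G) * √S₄) := by
        refine mul_le_mul (by linarith) (by linarith) (by positivity) (by positivity)
      _ = (K * (N + G)) ^ 2 * √S₄ ^ 2 := by ring
      _ = _ := by rw [Real.sq_sqrt hS₄0]
  have hS₄sq : S₄ ^ 2 ≤ S₂ * S₆ := by
    have h := sum_mul_sq_le_sq_mul_sq univ (fun x => |F x|) fun x => |F x| ^ 3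
    have hprod : ∀ x, |F x| * |F x| ^ 3 = F x ^ 4 := fun x => by
      rw [← pow_succ', (by decide : Even 4).pow_abs]
    simp only [hprod, sq_abs, ← pow_mul] at h
    rwa [← hS₂F, ← hS₆F] at h
  have hNle : N ≤ K * (N + G) := by
    rw [hK]
    nlinarith [mul_nonneg hL'.le hN0, mul_nonneg hL'.le hG0]
  have hfinal : (L / m) ^ 2 * S₆ ≤ (K * (N + G)) ^ 6 :=
    sq_mul_le_pow_six hN0 hNle hS₂0 hS₆0 hNsq hS₆S₄ hS₄sq
  calc ((L / m) ^ 2 * S₆) ^ ((1 : ℝ) / 6)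
      ≤ ((K * (N + G)) ^ 6) ^ ((1 : ℝ) / 6) := by gcongr
    _ = K * (N + G) := by
      rw [one_div]
      exact_mod_cast Real.pow_rpow_inv_natCast (n := 6) (by positivity) (by norm_num)
end

section
/- Let ε > 0, τ > 0, A ≥ 0, and let φᵏ, φᵏ⁻¹ be periodic grid functions on the m×m grid with spacing h = L/m having equal averages β₀. Then there exists a unique periodic grid function φ such that (3/2·φ − 2·φᵏ + 1/2·φᵏ⁻¹)/τ = Δ_{h,(4)} ( φ³ − 2φᵏ + φᵏ⁻¹ − ε² Δ_{h,(4)} φ − A τ Δ_{h,(4)}(φ − φᵏ) ), where φ³ denotes the pointwise cube. Moreover, any such solution φ has average equal to β₀. -/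
open Finset

/-- The average of a periodic grid function: `φ̄ = (1/m²) ∑_{i,j} φ_{i,j}`. -/
noncomputable def gridAvg (m : ℕ) [NeZero m] (φ : ZMod m → ZMod m → ℝ) : ℝ :=
  (1 / (m : ℝ) ^ 2) * ∑ i : ZMod m, ∑ j : ZMod m, φ i j

/-- The second-order BDF fourth-order finite difference scheme for the Cahn-Hilliard
equation, with interface parameter `ε`, time step `τ` and Douglas-Dupont
regularization parameter `A`: `φ` is the new time level computed from `φk, φkm`. -/
def chScheme (m : ℕ) (h ε τ A : ℝ) (φk φkm φ : ZMod m → ZMod m → ℝ) : Prop :=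
  ∀ i j : ZMod m,
    (3 / 2 * φ i j - 2 * φk i j + 1 / 2 * φkm i j) / τ
      = lap4 m h
          (fun a b => (φ a b) ^ 3 - 2 * φk a b + φkm a b - ε ^ 2 * lap4 m h φ a b
            - A * τ * lap4 m h (fun c d => φ c d - φk c d) a b) i j

section MonotoneProblem

variable {ι : Type*} [Fintype ι]

lemma abs_sub_le_quartic (x f g : ℝ) :
    |x - g| - (1 + (1 + |f|) ^ 2 / 4 + |g|) ≤ x ^ 4 / 4 + f * x := by
  have h₁ : |x - g| ≤ |x| + |g| := abs_sub x g
  have h₂ : -(|f| * |x|) ≤ f * x := by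
    rw [← abs_mul]
    exact neg_abs_le _
  have h₃ : x ^ 2 = |x| ^ 2 := (sq_abs x).symm
  nlinarith [sq_nonneg (x ^ 2 - 2), sq_nonneg (|x| - (1 + |f|) / 2)]

/-- The convex energy of `κ (φ - g) = -G (φ³ + f + c G φ)` in the increment `d = φ - g`,
where `S` is a right inverse of `G`. -/
noncomputable def incrementEnergy (G : (ι → ℝ) →ₗ[ℝ] (ι → ℝ))
    (S : LinearMap.range G →ₗ[ℝ] (ι → ℝ)) (κ c : ℝ) (f g : ι → ℝ)
    (d : LinearMap.range G) : ℝ :=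
  ∑ i, (κ / 2 * (S d i * (d : ι → ℝ) i) + ((g i + (d : ι → ℝ) i) ^ 4 / 4
    + f i * (g i + (d : ι → ℝ) i)) + c / 2 * ((g i + (d : ι → ℝ) i) * (G g i + G d i)))

variable {G : (ι → ℝ) →ₗ[ℝ] (ι → ℝ)}

lemma norm_sub_le_incrementEnergy (hpos : ∀ u, 0 ≤ ∑ i, u i * G u i)
    {S : LinearMap.range G →ₗ[ℝ] (ι → ℝ)} (hS : ∀ d, G (S d) = d)
    {κ c : ℝ} (hκ : 0 < κ) (hc : 0 ≤ c) (f g : ι → ℝ) (d : LinearMap.range G) :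
    ‖d‖ - ∑ i, (1 + (1 + |f i|) ^ 2 / 4 + |g i|) ≤ incrementEnergy G S κ c f g d := by
  have h₁ : 0 ≤ ∑ i, S d i * (d : ι → ℝ) i := by
    have := hpos (S d)
    rwa [hS] at this
  have h₂ : 0 ≤ ∑ i, (g i + (d : ι → ℝ) i) * (G g i + G d i) := by
    have := hpos (g + d)
    rwa [map_add] at this
  have h₃ : ‖d‖ ≤ ∑ i, |(d : ι → ℝ) i| := by
    refine (pi_norm_le_iff_of_nonneg (Finset.sum_nonneg fun i _ => abs_nonneg _)).2 fun i => ?_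
    exact Finset.single_le_sum (f := fun i => |(d : ι → ℝ) i|)
      (fun i _ => abs_nonneg _) (Finset.mem_univ i)
  have h₄ : ∑ i, (|(d : ι → ℝ) i| - (1 + (1 + |f i|) ^ 2 / 4 + |g i|))
      ≤ ∑ i, ((g i + (d : ι → ℝ) i) ^ 4 / 4 + f i * (g i + (d : ι → ℝ) i)) := by
    refine Finset.sum_le_sum fun i _ => ?_
    simpa using abs_sub_le_quartic (g i + (d : ι → ℝ) i) (f i) (g i)
  rw [Finset.sum_sub_distrib] at h₄
  have hsplit : incrementEnergy G S κ c f g d = κ / 2 * ∑ i, S d i * (d : ι → ℝ) i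
      + ∑ i, ((g i + (d : ι → ℝ) i) ^ 4 / 4 + f i * (g i + (d : ι → ℝ) i))
      + c / 2 * ∑ i, (g i + (d : ι → ℝ) i) * (G g i + G d i) := by
    rw [Finset.mul_sum, Finset.mul_sum, ← Finset.sum_add_distrib, ← Finset.sum_add_distrib,
      incrementEnergy]
  have := mul_nonneg (half_pos hκ).le h₁
  have := mul_nonneg (div_nonneg hc zero_le_two) h₂
  linarith

lemma exists_forall_incrementEnergy_le (hpos : ∀ u, 0 ≤ ∑ i, u i * G u i)
    {S : LinearMap.range G →ₗ[ℝ] (ι → ℝ)} (hS : ∀ d, G (S d) = d)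
    {κ c : ℝ} (hκ : 0 < κ) (hc : 0 ≤ c) (f g : ι → ℝ) :
    ∃ d, ∀ e, incrementEnergy G S κ c f g d ≤ incrementEnergy G S κ c f g e := by
  have hScont : Continuous S := S.continuous_of_finiteDimensional
  have hGcont : Continuous G := G.continuous_of_finiteDimensional
  have hcont : Continuous (incrementEnergy G S κ c f g) := by
    have hSi (i : ι) : Continuous fun d => S d i := (continuous_apply i).comp hScont
    have hGi (i : ι) : Continuous fun d : LinearMap.range G => G d i :=
      (continuous_apply i).comp (hGcont.comp continuous_subtype_val)
    have hdi (i : ι) : Continuous fun d : LinearMap.range G => (d : ι → ℝ) i :=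
      (continuous_apply i).comp continuous_subtype_val
    refine continuous_finsetSum _ fun i _ => ?_
    have hφi := (hdi i).const_add (g i)
    exact ((((hSi i).mul (hdi i)).const_mul _).add (((hφi.pow 4).div_const 4).add
      (hφi.const_mul _))).add ((hφi.mul ((hGi i).const_add _)).const_mul _)
  refine hcont.exists_forall_le ?_
  refine Filter.tendsto_atTop_mono (norm_sub_le_incrementEnergy hpos hS hκ hc f g) ?_
  exact Filter.tendsto_atTop_add_const_right _ _ (tendsto_norm_cocompact_atTop)

lemma hasDerivAt_incrementEnergy (hsymm : ∀ u v, ∑ i, u i * G v i = ∑ i, G u i * v i)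
    {S : LinearMap.range G →ₗ[ℝ] (ι → ℝ)} (hS : ∀ d, G (S d) = d)
    (κ c : ℝ) (f g : ι → ℝ) (d e : LinearMap.range G) :
    HasDerivAt (fun t : ℝ => incrementEnergy G S κ c f g (d + t • e))
      (∑ i, (κ * S d i + ((g i + (d : ι → ℝ) i) ^ 3 + f i + c * (G g i + G d i)))
        * (e : ι → ℝ) i) 0 := by
  have hderiv : HasDerivAt (fun t : ℝ => incrementEnergy G S κ c f g (d + t • e))
      (∑ i, (κ / 2 * (S e i * (d : ι → ℝ) i + S d i * (e : ι → ℝ) i)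
        + ((g i + (d : ι → ℝ) i) ^ 3 * (e : ι → ℝ) i + f i * (e : ι → ℝ) i)
        + c / 2 * ((e : ι → ℝ) i * (G g i + G d i)
          + (g i + (d : ι → ℝ) i) * G e i))) 0 := by
    simp only [incrementEnergy, map_add, map_smul, Submodule.coe_add, Submodule.coe_smul,
      Pi.add_apply, Pi.smul_apply, smul_eq_mul]
    refine HasDerivAt.fun_sum fun i _ => ?_
    have hlin (a b : ℝ) : HasDerivAt (fun t : ℝ => a + t * b) b 0 := by
      simpa using ((hasDerivAt_id (0 : ℝ)).mul_const b).const_add a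
    have hφ := (hlin ((d : ι → ℝ) i) ((e : ι → ℝ) i)).const_add (g i)
    have hGφ := (hlin (G d i) (G e i)).const_add (G g i)
    refine HasDerivAt.congr_deriv (((((hlin (S d i) (S e i)).mul (hlin ((d : ι → ℝ) i) ((e : ι → ℝ) i))).const_mul
      (κ / 2)).add (((hφ.pow 4).div_const 4).add (hφ.const_mul (f i)))).add
      ((hφ.mul hGφ).const_mul (c / 2))) ?_
    simp only [zero_mul, add_zero]
    norm_num
    ring
  convert hderiv using 1
  have h₁ : ∑ i, S e i * (d : ι → ℝ) i = ∑ i, S d i * (e : ι → ℝ) i := by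
    have := hsymm (S e) (S d)
    rw [hS, hS] at this
    simpa only [mul_comm] using this
  have h₂ : ∑ i, (g i + (d : ι → ℝ) i) * G e i = ∑ i, (G g i + G d i) * (e : ι → ℝ) i := by
    have := hsymm (g + d) e
    rwa [map_add] at this
  have h₃ : ∑ i, (κ / 2 * (S e i * (d : ι → ℝ) i - S d i * (e : ι → ℝ) i)
      + c / 2 * ((g i + (d : ι → ℝ) i) * G e i - (G g i + G d i) * (e : ι → ℝ) i)) = 0 := by
    rw [Finset.sum_add_distrib, ← Finset.mul_sum, ← Finset.mul_sum, Finset.sum_sub_distrib,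
      Finset.sum_sub_distrib, h₁, h₂]
    ring
  rw [← sub_eq_zero, ← neg_eq_zero, neg_sub, ← h₃, ← Finset.sum_sub_distrib]
  exact Finset.sum_congr rfl fun i _ => by ring

theorem exists_cubic_solution (hsymm : ∀ u v, ∑ i, u i * G v i = ∑ i, G u i * v i)
    (hpos : ∀ u, 0 ≤ ∑ i, u i * G u i) {κ c : ℝ} (hκ : 0 < κ) (hc : 0 ≤ c) (f g : ι → ℝ) :
    ∃ φ : ι → ℝ, κ • (φ - g) = -G (φ ^ 3 + f + c • G φ) := by
  obtain ⟨S, hS⟩ := G.rangeRestrict.exists_rightInverse_of_surjective G.range_rangeRestrict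
  have hS (d : LinearMap.range G) : G (S d) = d :=
    congrArg Subtype.val (LinearMap.congr_fun hS d)
  obtain ⟨d, hd⟩ := exists_forall_incrementEnergy_le hpos hS hκ hc f g
  refine ⟨g + d, ?_⟩
  set w : ι → ℝ := κ • S d + ((g + d) ^ 3 + f + c • G (g + d)) with hw
  have hzero : G w = 0 := by
    have hmin : IsLocalMin (fun t : ℝ => incrementEnergy G S κ c f g
        (d + t • (⟨G (G w), LinearMap.mem_range_self _ _⟩ : LinearMap.range G))) 0 :=
      Filter.Eventually.of_forall fun t => by simpa using hd _
    have := hmin.hasDerivAt_eq_zero (hasDerivAt_incrementEnergy hsymm hS κ c f g d _)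
    have hsum : ∑ i, w i * G (G w) i = 0 := by
      rw [← this]
      refine Finset.sum_congr rfl fun i _ => ?_
      simp only [hw, map_add, Pi.add_apply, Pi.smul_apply, Pi.pow_apply, smul_eq_mul]
    rw [hsymm] at hsum
    have := (Finset.sum_eq_zero_iff_of_nonneg fun i _ => mul_self_nonneg (G w i)).1 hsum
    exact funext fun i => mul_self_eq_zero.1 (this i (Finset.mem_univ i))
  rw [hw, map_add, map_smul, hS] at hzero
  rw [add_sub_cancel_left]
  exact eq_neg_of_add_eq_zero_left hzero

theorem cubic_solution_unique (hpos : ∀ u, 0 ≤ ∑ i, u i * G u i) {κ c : ℝ} (hκ : 0 < κ)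
    (hc : 0 ≤ c) {f g φ ψ : ι → ℝ} (hφ : κ • (φ - g) = -G (φ ^ 3 + f + c • G φ))
    (hψ : κ • (ψ - g) = -G (ψ ^ 3 + f + c • G ψ)) : φ = ψ := by
  set w : ι → ℝ := φ ^ 3 - ψ ^ 3 + c • G (φ - ψ) with hw
  have hd : κ • (φ - ψ) = -G w := by
    have : w = (φ ^ 3 + f + c • G φ) - (ψ ^ 3 + f + c • G ψ) := by
      rw [hw, map_sub, smul_sub]
      abel
    rw [this, map_sub, neg_sub', ← hφ, sub_neg_eq_add, ← neg_eq_iff_eq_neg.2 hψ, ← sub_eq_add_neg,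
      ← smul_sub, sub_sub_sub_cancel_right]
  have h₁ : κ * ∑ i, w i * (φ i - ψ i) ≤ 0 := by
    have : κ * ∑ i, w i * (φ i - ψ i) = -∑ i, w i * G w i := by
      rw [Finset.mul_sum, ← Finset.sum_neg_distrib]
      refine Finset.sum_congr rfl fun i _ => ?_
      have := congrFun hd i
      simp only [Pi.smul_apply, Pi.sub_apply, Pi.neg_apply, smul_eq_mul] at this
      linear_combination w i * this
    linarith [hpos w]
  have h₂ : ∑ i, w i * (φ i - ψ i) ≤ 0 := nonpos_of_mul_nonpos_right h₁ hκ
  have h₃ : ∑ i, w i * (φ i - ψ i) = ∑ i, (φ i ^ 3 - ψ i ^ 3) * (φ i - ψ i)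
      + c * ∑ i, (φ - ψ) i * G (φ - ψ) i := by
    rw [Finset.mul_sum, ← Finset.sum_add_distrib]
    refine Finset.sum_congr rfl fun i _ => ?_
    simp only [hw, Pi.add_apply, Pi.sub_apply, Pi.pow_apply, Pi.smul_apply, smul_eq_mul]
    ring
  have hcube (x y : ℝ) : (x - y) ^ 4 / 4 ≤ (x ^ 3 - y ^ 3) * (x - y) := by
    have : (x ^ 3 - y ^ 3) * (x - y) - (x - y) ^ 4 / 4 = 3 / 4 * ((x - y) * (x + y)) ^ 2 := by
      ring
    nlinarith [sq_nonneg ((x - y) * (x + y))]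
  have h₄ : ∑ i, (φ i - ψ i) ^ 4 / 4 ≤ 0 :=
    (Finset.sum_le_sum fun i _ => hcube (φ i) (ψ i)).trans
      (by linarith [mul_nonneg hc (hpos (φ - ψ))])
  have hnonneg : ∀ i ∈ Finset.univ, 0 ≤ (φ i - ψ i) ^ 4 / 4 := fun i _ => by positivity
  have h₅ := (Finset.sum_eq_zero_iff_of_nonneg hnonneg).1 (h₄.antisymm (Finset.sum_nonneg hnonneg))
  refine funext fun i => sub_eq_zero.1 ?_
  simpa using h₅ i (Finset.mem_univ i)

end MonotoneProblem

section LongStencil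

variable {m : ℕ}

/-- `12h²` times the negative one-dimensional long-stencil second difference. -/
def longStencil (u : ZMod m → ℝ) (i : ZMod m) : ℝ :=
  u (i - 2) - 16 * u (i - 1) + 30 * u i - 16 * u (i + 1) + u (i + 2)

lemma lap4_eq_longStencil (h : ℝ) (φ : ZMod m → ZMod m → ℝ) (i j : ZMod m) :
    lap4 m h φ i j
      = -(longStencil (fun a => φ a j) i + longStencil (φ i) j) / (12 * h ^ 2) := by
  simp only [lap4, longStencil]
  ring

/-- The operator `-Δ_{h,(4)}` on uncurried grid functions. -/
noncomputable def negLap4 (m : ℕ) (h : ℝ) :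
    (ZMod m × ZMod m → ℝ) →ₗ[ℝ] (ZMod m × ZMod m → ℝ) where
  toFun u p := -lap4 m h (fun i j => u (i, j)) p.1 p.2
  map_add' u v := by
    ext p
    simp only [lap4, Pi.add_apply]
    ring
  map_smul' a u := by
    ext p
    simp only [lap4, Pi.smul_apply, smul_eq_mul, RingHom.id_apply]
    ring

lemma chScheme_iff (h ε A : ℝ) {τ : ℝ} (hτ : 0 < τ) (φk φkm φ : ZMod m → ZMod m → ℝ) :
    chScheme m h ε τ A φk φkm φ ↔
      (3 / (2 * τ)) • ((fun p : ZMod m × ZMod m => φ p.1 p.2)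
          - fun p => 4 / 3 * φk p.1 p.2 - 1 / 3 * φkm p.1 p.2)
        = -negLap4 m h ((fun p => φ p.1 p.2) ^ 3
            + (fun p => -2 * φk p.1 p.2 + φkm p.1 p.2 + A * τ * lap4 m h φk p.1 p.2)
            + (ε ^ 2 + A * τ) • negLap4 m h fun p => φ p.1 p.2) := by
  have hsub (a b : ZMod m) : lap4 m h (fun c d => φ c d - φk c d) a b
      = lap4 m h φ a b - lap4 m h φk a b := by
    simp only [lap4]
    ring
  rw [funext_iff, Prod.forall]
  refine forall₂_congr fun i j => ?_
  simp only [negLap4, LinearMap.coe_mk, AddHom.coe_mk, Pi.smul_apply, Pi.sub_apply,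
    Pi.neg_apply, Pi.add_apply, Pi.pow_apply, smul_eq_mul, neg_neg, hsub]
  have hleft : (3 / 2 * φ i j - 2 * φk i j + 1 / 2 * φkm i j) / τ
      = 3 / (2 * τ) * (φ i j - (4 / 3 * φk i j - 1 / 3 * φkm i j)) := by
    field_simp
    ring
  have hright : (fun a b => φ a b ^ 3 - 2 * φk a b + φkm a b - ε ^ 2 * lap4 m h φ a b
        - A * τ * (lap4 m h φ a b - lap4 m h φk a b))
      = fun a b => φ a b ^ 3 + (-2 * φk a b + φkm a b + A * τ * lap4 m h φk a b)
        + (ε ^ 2 + A * τ) * -lap4 m h φ a b := by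
    funext a b
    ring
  rw [hleft, hright]

variable [NeZero m]

lemma sum_mul_sub (u v : ZMod m → ℝ) (a : ZMod m) :
    ∑ i, u i * v (i - a) = ∑ i, u (i + a) * v i := by
  rw [← Equiv.sum_comp (Equiv.addRight a)]
  simp

lemma sum_mul_longStencil_comm (u v : ZMod m → ℝ) :
    ∑ i, u i * longStencil v i = ∑ i, longStencil u i * v i := by
  have h₁ := sum_mul_sub u v 1
  have h₂ := sum_mul_sub u v 2
  have h₃ := sum_mul_sub v u 1
  have h₄ := sum_mul_sub v u 2
  simp only [mul_comm (v _)] at h₃ h₄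
  simp only [longStencil, mul_add, mul_sub, add_mul, sub_mul, Finset.sum_add_distrib,
    Finset.sum_sub_distrib, mul_left_comm _ (16 : ℝ), mul_left_comm _ (30 : ℝ), mul_assoc,
    ← Finset.mul_sum]
  linarith

lemma sum_longStencil (u : ZMod m → ℝ) : ∑ i, longStencil u i = 0 := by
  have := sum_mul_longStencil_comm u 1
  simp only [longStencil, Pi.one_apply, mul_one] at this
  simp only [longStencil, ← this]
  exact Finset.sum_eq_zero fun i _ => by ring

lemma sum_mul_longStencil_nonneg (u : ZMod m → ℝ) : 0 ≤ ∑ i, u i * longStencil u i := by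
  have hshift (v : ZMod m → ℝ) (a : ZMod m) : ∑ i, v (i + a) = ∑ i, v i :=
    Equiv.sum_comp (Equiv.addRight a) v
  have h₁ := sum_mul_sub u u 1
  have h₂ := sum_mul_sub u u 2
  have h₃ := hshift (fun i => u i ^ 2) 1
  have h₄ := hshift (fun i => u i ^ 2) 2
  have h₅ := hshift (fun i => (u (i + 1) - u i) ^ 2) 1
  have h₆ : ∑ i, (u (i + 2) - u i) ^ 2
      ≤ ∑ i, (2 * (u (i + 1 + 1) - u (i + 1)) ^ 2 + 2 * (u (i + 1) - u i) ^ 2) := by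
    refine Finset.sum_le_sum fun i _ => ?_
    rw [add_assoc i 1 1, one_add_one_eq_two]
    nlinarith [sq_nonneg ((u (i + 2) - u (i + 1)) - (u (i + 1) - u i))]
  have h₇ : 0 ≤ ∑ i, (u (i + 1) - u i) ^ 2 := Finset.sum_nonneg fun i _ => sq_nonneg _
  rw [Finset.sum_add_distrib, ← Finset.mul_sum, ← Finset.mul_sum, h₅] at h₆
  have hexp (a : ZMod m) : ∑ i, (u (i + a) - u i) ^ 2
      = ∑ i, u (i + a) ^ 2 - 2 * ∑ i, u (i + a) * u i + ∑ i, u i ^ 2 := by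
    simp only [sub_sq, Finset.sum_add_distrib, Finset.sum_sub_distrib, mul_assoc,
      ← Finset.mul_sum]
  have h₈ (a : ZMod m) : ∑ i, u i * u (i + a) = ∑ i, u (i + a) * u i := by
    simp only [mul_comm]
  rw [hexp, hexp] at h₆
  rw [hexp] at h₇
  simp only [longStencil, mul_add, mul_sub, Finset.sum_add_distrib, Finset.sum_sub_distrib,
    mul_left_comm _ (16 : ℝ), mul_left_comm _ (30 : ℝ), ← Finset.mul_sum, h₈, h₁, h₂]
  simp only [← sq]
  linarith

lemma sum_lap4 (h : ℝ) (φ : ZMod m → ZMod m → ℝ) : ∑ i, ∑ j, lap4 m h φ i j = 0 := by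
  have h₁ : ∑ i, ∑ j, longStencil (fun a => φ a j) i = 0 := by
    rw [Finset.sum_comm]
    exact Finset.sum_eq_zero fun j _ => sum_longStencil _
  have h₂ : ∑ i, ∑ j, longStencil (φ i) j = 0 := Finset.sum_eq_zero fun i _ => sum_longStencil _
  simp only [lap4_eq_longStencil, ← Finset.sum_div, Finset.sum_neg_distrib,
    Finset.sum_add_distrib, h₁, h₂]
  simp

lemma sum_mul_negLap4 (h : ℝ) (u v : ZMod m × ZMod m → ℝ) :
    ∑ p, u p * negLap4 m h v p
      = (∑ j, ∑ i, u (i, j) * longStencil (fun a => v (a, j)) i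
        + ∑ i, ∑ j, u (i, j) * longStencil (fun b => v (i, b)) j) / (12 * h ^ 2) := by
  rw [Finset.sum_comm, Fintype.sum_prod_type, ← Finset.sum_add_distrib, Finset.sum_div]
  refine Finset.sum_congr rfl fun i _ => ?_
  rw [← Finset.sum_add_distrib, Finset.sum_div]
  refine Finset.sum_congr rfl fun j _ => ?_
  simp only [negLap4, LinearMap.coe_mk, AddHom.coe_mk, lap4_eq_longStencil]
  ring

lemma sum_mul_negLap4_comm (h : ℝ) (u v : ZMod m × ZMod m → ℝ) :
    ∑ p, u p * negLap4 m h v p = ∑ p, negLap4 m h u p * v p := by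
  have := sum_mul_negLap4 h v u
  simp only [mul_comm (v _)] at this
  rw [this, sum_mul_negLap4]
  congr 2
  · exact Finset.sum_congr rfl fun j _ => sum_mul_longStencil_comm _ _
  · exact Finset.sum_congr rfl fun i _ => sum_mul_longStencil_comm _ _

lemma sum_mul_negLap4_nonneg (h : ℝ) (u : ZMod m × ZMod m → ℝ) :
    0 ≤ ∑ p, u p * negLap4 m h u p := by
  rw [sum_mul_negLap4]
  refine div_nonneg (add_nonneg ?_ ?_) (by positivity)
  · exact Finset.sum_nonneg fun j _ => sum_mul_longStencil_nonneg _
  · exact Finset.sum_nonneg fun i _ => sum_mul_longStencil_nonneg _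

lemma gridAvg_eq_of_chScheme {h ε τ A β₀ : ℝ} (hτ : 0 < τ) {φk φkm φ : ZMod m → ZMod m → ℝ}
    (hφk : gridAvg m φk = β₀) (hφkm : gridAvg m φkm = β₀)
    (hφ : chScheme m h ε τ A φk φkm φ) : gridAvg m φ = β₀ := by
  have hsum : ∑ i, ∑ j, (3 / 2 * φ i j - 2 * φk i j + 1 / 2 * φkm i j) / τ = 0 := by
    rw [Finset.sum_congr rfl fun i _ => Finset.sum_congr rfl fun j _ => hφ i j]
    exact sum_lap4 _ _
  simp only [← Finset.sum_div, Finset.sum_add_distrib, Finset.sum_sub_distrib,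
    ← Finset.mul_sum, div_eq_zero_iff, hτ.ne', or_false] at hsum
  simp only [gridAvg] at *
  linear_combination (2 / 3 * (1 / (m : ℝ) ^ 2)) * hsum + 4 / 3 * hφk - 1 / 3 * hφkm

end LongStencil

/-- Unique solvability and mass conservation of the BDF2 fourth-order finite
difference scheme for the Cahn-Hilliard equation. -/
theorem chScheme_unique_solvability (L : ℝ) (hL : 0 < L) (m : ℕ) [NeZero m]
    (h : ℝ) (hh : h = L / m) (ε τ A β₀ : ℝ) (hε : 0 < ε) (hτ : 0 < τ) (hA : 0 ≤ A)
    (φk φkm : ZMod m → ZMod m → ℝ)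
    (hφk : gridAvg m φk = β₀) (hφkm : gridAvg m φkm = β₀) :
    (∃! φ : ZMod m → ZMod m → ℝ, chScheme m h ε τ A φk φkm φ) ∧
      ∀ φ : ZMod m → ZMod m → ℝ, chScheme m h ε τ A φk φkm φ → gridAvg m φ = β₀ := by
  have hc : 0 ≤ ε ^ 2 + A * τ := by positivity
  have hκ : 0 < 3 / (2 * τ) := by positivity
  refine ⟨?_, fun φ hφ => gridAvg_eq_of_chScheme hτ hφk hφkm hφ⟩
  obtain ⟨φ, hφ⟩ := exists_cubic_solution (sum_mul_negLap4_comm h) (sum_mul_negLap4_nonneg h)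
    hκ hc (fun p => -2 * φk p.1 p.2 + φkm p.1 p.2 + A * τ * lap4 m h φk p.1 p.2)
    (fun p => 4 / 3 * φk p.1 p.2 - 1 / 3 * φkm p.1 p.2)
  refine ⟨fun i j => φ (i, j), (chScheme_iff h ε A hτ φk φkm _).2 hφ, fun ψ hψ => ?_⟩
  have := cubic_solution_unique (sum_mul_negLap4_nonneg h) hκ hc
    ((chScheme_iff h ε A hτ φk φkm ψ).1 hψ) hφ
  exact funext₂ fun i j => congrFun this (i, j)
end

section
/- Fix T > 0, a positive integer M, and τ > 0 with τ ≤ T/M. Let (a_m)_{m=0}^{M}, (b_m)_{m=0}^{M}, and (c_m)_{m=0}^{M−1} be sequences of nonnegative real numbers such that τ ∑_{m=0}^{M−1} c_m ≤ D₁ for some constant D₁ ≥ 0. Suppose there are constants D₂ > 0 and 0 < α < 1 such that for all 1 ≤ ℓ ≤ M, a_ℓ + τ ∑_{m=0}^{ℓ} b_m ≤ D₂ + τ ∑_{m=0}^{ℓ−1} c_m ∑_{j=0}^{m} α^{m−j} a_j. Then for all 1 ≤ ℓ ≤ M, a_ℓ + τ ∑_{m=0}^{ℓ} b_m ≤ (D₂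 + a₀ D₁) · exp( D₁/(1−α) ). -/
open Finset

/-- The sum of `x n * exp (x 0 + ⋯ + x (n - 1))` is dominated by a telescoping sum. -/
lemma one_add_sum_mul_exp_sum_le (x : ℕ → ℝ) (l : ℕ) :
    1 + ∑ n ∈ range l, x n * Real.exp (∑ i ∈ range n, x i) ≤ Real.exp (∑ i ∈ range l, x i) := by
  induction l with
  | zero => simp
  | succ l ih =>
    rw [sum_range_succ, sum_range_succ, Real.exp_add]
    nlinarith [Real.add_one_le_exp (x l), Real.exp_pos (∑ i ∈ range l, x i)]

lemma geom_sum_le_inv_one_sub {α : ℝ} (hα0 : 0 ≤ α) (hα1 : α < 1) (n : ℕ) :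
    ∑ i ∈ range n, α ^ i ≤ (1 - α)⁻¹ := by
  rw [← tsum_geometric_of_lt_one hα0 hα1]
  exact (summable_geometric_of_lt_one hα0 hα1).sum_le_tsum _ fun i _ => pow_nonneg hα0 i

/-- A geometrically weighted sum is bounded by its initial value plus a bound on the others. -/
lemma sum_pow_mul_le {α : ℝ} (hα0 : 0 ≤ α) (hα1 : α < 1) {a : ℕ → ℝ} {B : ℝ} {n : ℕ}
    (ha : 0 ≤ a 0) (hB : 0 ≤ B) (h : ∀ j, 1 ≤ j → j ≤ n → a j ≤ B) :
    ∑ j ∈ range (n + 1), α ^ (n - j) * a j ≤ a 0 + (1 - α)⁻¹ * B := by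
  rw [sum_range_succ', add_comm]
  refine add_le_add (mul_le_of_le_one_left ha (pow_le_one₀ hα0 hα1.le)) ?_
  calc ∑ j ∈ range n, α ^ (n - (j + 1)) * a (j + 1)
      ≤ ∑ j ∈ range n, α ^ (n - 1 - j) * B := by
        refine sum_le_sum fun j hj => ?_
        rw [mem_range] at hj
        rw [show n - (j + 1) = n - 1 - j by omega]
        exact mul_le_mul_of_nonneg_left (h _ (by omega) (by omega)) (pow_nonneg hα0 _)
    _ = (∑ i ∈ range n, α ^ i) * B := by
        rw [← sum_mul, sum_range_reflect (fun i => α ^ i)]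
    _ ≤ (1 - α)⁻¹ * B := mul_le_mul_of_nonneg_right (geom_sum_le_inv_one_sub hα0 hα1 n) hB

/-- A modified discrete Gronwall inequality adapted to BDF2-type schemes. -/
theorem modified_discrete_gronwall (T : ℝ) (hT : 0 < T) (M : ℕ) (hM : 0 < M)
    (τ : ℝ) (hτ : 0 < τ) (hτM : τ ≤ T / M)
    (a b c : ℕ → ℝ)
    (ha : ∀ n, n ≤ M → 0 ≤ a n) (hb : ∀ n, n ≤ M → 0 ≤ b n)
    (hc : ∀ n, n < M → 0 ≤ c n)
    (D₁ : ℝ) (hD₁ : 0 ≤ D₁) (hcsum : τ * ∑ n ∈ Finset.range M, c n ≤ D₁)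
    (D₂ α : ℝ) (hD₂ : 0 < D₂) (hα0 : 0 < α) (hα1 : α < 1)
    (hrec : ∀ l, 1 ≤ l → l ≤ M →
      a l + τ * ∑ n ∈ Finset.range (l + 1), b n
        ≤ D₂ + τ * ∑ n ∈ Finset.range l,
            c n * ∑ j ∈ Finset.range (n + 1), α ^ (n - j) * a j) :
    ∀ l, 1 ≤ l → l ≤ M →
      a l + τ * ∑ n ∈ Finset.range (l + 1), b n
        ≤ (D₂ + a 0 * D₁) * Real.exp (D₁ / (1 - α)) := by
  have hα : 0 < 1 - α := sub_pos.2 hα1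
  have ha0 : 0 ≤ a 0 := ha 0 hM.le
  have hK : 0 ≤ D₂ + a 0 * D₁ := by positivity
  set K := D₂ + a 0 * D₁ with hKdef
  set x : ℕ → ℝ := fun n => τ * (1 - α)⁻¹ * c n with hx
  have hx0 : ∀ n, n < M → 0 ≤ x n := fun n hn => by
    have := hc n hn
    positivity
  have hmono : ∀ m n, m ≤ n → n ≤ M → ∑ i ∈ range m, x i ≤ ∑ i ∈ range n, x i :=
    fun m n hmn hn => sum_le_sum_of_subset_of_nonneg (range_mono hmn)
      fun i hi _ => hx0 i ((mem_range.1 hi).trans_le hn)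
  have hcle : ∀ l, l ≤ M → τ * ∑ n ∈ range l, c n ≤ D₁ := fun l hl =>
    (mul_le_mul_of_nonneg_left (sum_le_sum_of_subset_of_nonneg (range_mono hl)
      fun i hi _ => hc i (mem_range.1 hi)) hτ.le).trans hcsum
  have key : ∀ l, 1 ≤ l → l ≤ M →
      a l + τ * ∑ n ∈ range (l + 1), b n ≤ K * Real.exp (∑ i ∈ range l, x i) := by
    intro l
    induction l using Nat.strong_induction_on with
    | _ l ih =>
      intro hl1 hlM
      have hbound : ∀ j, 1 ≤ j → j < l → a j ≤ K * Real.exp (∑ i ∈ range j, x i) := by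
        intro j hj1 hjl
        have hbj : 0 ≤ τ * ∑ n ∈ range (j + 1), b n :=
          mul_nonneg hτ.le (sum_nonneg fun i hi => hb i (by rw [mem_range] at hi; omega))
        linarith [ih j hjl hj1 (by omega)]
      calc a l + τ * ∑ n ∈ range (l + 1), b n
          ≤ D₂ + τ * ∑ n ∈ range l, c n * ∑ j ∈ range (n + 1), α ^ (n - j) * a j :=
            hrec l hl1 hlM
        _ ≤ D₂ + τ * ∑ n ∈ range l,
              c n * (a 0 + (1 - α)⁻¹ * (K * Real.exp (∑ i ∈ range n, x i))) := by
            gcongr with n hn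
            · exact hc n (by rw [mem_range] at hn; omega)
            · rw [mem_range] at hn
              refine sum_pow_mul_le hα0.le hα1 ha0 (by positivity) fun j hj1 hjn => ?_
              refine (hbound j hj1 (by omega)).trans ?_
              exact mul_le_mul_of_nonneg_left
                (Real.exp_le_exp.2 (hmono j n hjn (by omega))) hK
        _ = D₂ + a 0 * (τ * ∑ n ∈ range l, c n)
              + K * ∑ n ∈ range l, x n * Real.exp (∑ i ∈ range n, x i) := by
            simp only [mul_sum, add_assoc, ← sum_add_distrib]
            congr 1
            refine sum_congr rfl fun n _ => ?_
            simp only [hx]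
            ring
        _ ≤ K * (1 + ∑ n ∈ range l, x n * Real.exp (∑ i ∈ range n, x i)) := by
            rw [mul_add, mul_one]
            linarith [mul_le_mul_of_nonneg_left (hcle l hlM) ha0]
        _ ≤ K * Real.exp (∑ i ∈ range l, x i) :=
            mul_le_mul_of_nonneg_left (one_add_sum_mul_exp_sum_le x l) hK
  intro l hl1 hlM
  refine (key l hl1 hlM).trans ?_
  gcongr
  calc ∑ i ∈ range l, x i = (τ * ∑ n ∈ range l, c n) / (1 - α) := by
        rw [← mul_sum, div_eq_mul_inv]
        ring
    _ ≤ D₁ / (1 - α) := div_le_div_of_nonneg_right (hcle l hlM) hα.le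
end
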